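/- Let γ ∈ ℝ^d be a probability distribution with rational entries γ_i = c_i/N, where the c_i are positive integers with ∑_i c_i = N, let Γ denote the associated embedding map, and let η_N be the uniform distribution on N outcomes. Let p, q ∈ ℝ^d be probability distributions with D(p‖γ) > 0, D(q‖γ) > 0, V(p‖γ) > 0 and V(q‖γ) > 0. Let (t_n) be a moderate sequence and set ε_n = e^{−n t_n²}. For ε ≥ 0 define the optimal thermodynamic-direction conversion rate R_n^{th}(ε) = (1/n)·sup{ m ∈ ℕ : (Γp)^{⊗n} ⊗ η_N^{⊗m} ≻_ε (Γq)^{⊗m} ⊗ η_N^{⊗n} }, where ≻_ε is approximate majorisation with total variation error. Set ν = (V(p‖γ)/D(p‖γ)) / (V(q‖γ)/D(q‖γ)). Then lim_{n→∞} ( R_n^{th}(ε_n) − D(p‖γ)/D(q‖γ) ) / t_n = −(√(2 V(p‖γ)) / D(q‖γ)) · |1 − 1/√ν|. -/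

import Mathlib

open Finset Filter Real Topology

noncomputable section

/-- A probability distribution on a finite type: nonnegative entries summing to 1. -/
def IsProbDist {α : Type*} [Fintype α] (a : α → ℝ) : Prop :=
  (∀ i, 0 ≤ a i) ∧ ∑ i, a i = 1

/-- A sharp distribution: a single entry equal to 1, all others 0. -/
def IsSharp {α : Type*} [Fintype α] (a : α → ℝ) : Prop :=
  ∃ i, a i = 1 ∧ ∀ j, j ≠ i → a j = 0

/-- The uniform distribution: all entries equal to `1 / |α|`. -/
def IsUniform {α : Type*} [Fintype α] (a : α → ℝ) : Prop :=
  ∀ i, a i = 1 / (Fintype.card α : ℝ)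

/-- Tensor (Kronecker) product of two vectors. -/
def tensor {α β : Type*} (a : α → ℝ) (b : β → ℝ) : α × β → ℝ :=
  fun x => a x.1 * b x.2

/-- `n`-fold tensor power of a vector. -/
def tpow {α : Type*} (a : α → ℝ) (n : ℕ) : (Fin n → α) → ℝ :=
  fun f => ∏ j, a (f j)

/-- Shannon entropy (natural logarithm, with the convention `0 · ln 0 = 0`). -/
def shannonH {α : Type*} [Fintype α] (a : α → ℝ) : ℝ :=
  -∑ i, a i * Real.log (a i)

/-- Entropy variance `V(a) = ∑ i, a i (ln a i + H(a))²`. -/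
def entV {α : Type*} [Fintype α] (a : α → ℝ) : ℝ :=
  ∑ i, a i * (Real.log (a i) + shannonH a) ^ 2

/-- Relative entropy `D(a‖b)`. -/
def relD {α : Type*} [Fintype α] (a b : α → ℝ) : ℝ :=
  ∑ i, a i * Real.log (a i / b i)

/-- Relative entropy variance `V(a‖b)`. -/
def relV {α : Type*} [Fintype α] (a b : α → ℝ) : ℝ :=
  ∑ i, a i * (Real.log (a i / b i) - relD a b) ^ 2

/-- Total variation distance. -/
def tvd {α : Type*} [Fintype α] (a b : α → ℝ) : ℝ :=
  (1 / 2) * ∑ i, |a i - b i|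

/-- Fidelity `F(a,b) = (∑ i √(a i · b i))²`. -/
def fid {α : Type*} [Fintype α] (a b : α → ℝ) : ℝ :=
  (∑ i, Real.sqrt (a i * b i)) ^ 2

/-- The entries of `a` sorted in non-increasing order, as a vector on `Fin (card α)`. -/
def descSorted {α : Type*} [Fintype α] (a : α → ℝ) : Fin (Fintype.card α) → ℝ :=
  fun i =>
    a ((Fintype.equivFin α).symm
      (Tuple.sort (fun j => -a ((Fintype.equivFin α).symm j)) i))

/-- `headSum a K = ∑_{1 ≤ i ≤ K} a^↓_i` (1-based indices `i`, comparison `(i : ℝ) ≤ K`,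
equivalently `i ≤ ⌊K⌋`). -/
def headSum {α : Type*} [Fintype α] (a : α → ℝ) (K : ℝ) : ℝ :=
  ∑ i ∈ Finset.univ.filter (fun i : Fin (Fintype.card α) => ((i : ℕ) + 1 : ℝ) ≤ K),
    descSorted a i

/-- `tailSum a K = ∑_{i ≥ K} a^↓_i` (1-based indices `i`, comparison `K ≤ (i : ℝ)`,
equivalently `i ≥ ⌈K⌉`). -/
def tailSum {α : Type*} [Fintype α] (a : α → ℝ) (K : ℝ) : ℝ :=
  ∑ i ∈ Finset.univ.filter (fun i : Fin (Fintype.card α) => K ≤ ((i : ℕ) + 1 : ℝ)),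
    descSorted a i

/-- `a` majorises `b` (written `a ≻ b`): every partial sum of the non-increasingly sorted
`a` dominates the corresponding partial sum of sorted `b` (shorter vectors padded with zeros). -/
def Maj {α β : Type*} [Fintype α] [Fintype β] (a : α → ℝ) (b : β → ℝ) : Prop :=
  ∀ j : ℕ, headSum b (j : ℝ) ≤ headSum a (j : ℝ)

/-- `a ≻_ε b`: approximate majorisation (from above) with total variation error:
there is a probability distribution `b̃` with `a ≻ b̃` and `δ(b, b̃) ≤ ε`. -/
def ApproxMajTV {α β : Type*} [Fintype α] [Fintype β] (a : α → ℝ) (b : β → ℝ) (ε : ℝ) : Prop :=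
  ∃ bt : β → ℝ, IsProbDist bt ∧ Maj a bt ∧ tvd b bt ≤ ε

/-- `a ≺_ε b`: approximate majorisation (from below) with total variation error:
there is a probability distribution `b̃` with `a ≺ b̃` and `δ(b, b̃) ≤ ε`. -/
def ApproxSubMajTV {α β : Type*} [Fintype α] [Fintype β] (a : α → ℝ) (b : β → ℝ) (ε : ℝ) : Prop :=
  ∃ bt : β → ℝ, IsProbDist bt ∧ Maj bt a ∧ tvd b bt ≤ ε

/-- A moderate sequence: `t n → 0` and `√n · t n → +∞`. -/
def ModerateSeq (t : ℕ → ℝ) : Prop :=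
  Tendsto t atTop (𝓝 0) ∧ Tendsto (fun n : ℕ => Real.sqrt (n : ℝ) * t n) atTop atTop

/-- The uniform distribution on `Fin d`. -/
def unif (d : ℕ) : Fin d → ℝ := fun _ => 1 / (d : ℝ)

/-- The embedding map `Γ` associated with `γ_i = c_i / N`: for each `i` it produces
`c_i` entries equal to `a_i / c_i`. -/
def embed {d : ℕ} (c : Fin d → ℕ) (a : Fin d → ℝ) : (Σ i : Fin d, Fin (c i)) → ℝ :=
  fun x => a x.1 / (c x.1 : ℝ)

/-- Cut-and-pile modification of the sorted version of `a`, with cut at `K`: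
the first entry absorbs the total mass of entries at (1-based) positions `≥ K`,
entries at positions `1 < i < K` are unchanged, and entries at positions `≥ K` are set to 0. -/
def cutAndPile {α : Type*} [Fintype α] (a : α → ℝ) (K : ℝ) : Fin (Fintype.card α) → ℝ :=
  fun i =>
    if (i : ℕ) = 0 then descSorted a i + tailSum a K
    else if ((i : ℕ) + 1 : ℝ) < K then descSorted a i else 0

section Majorisation

variable {α β : Type*} [Fintype α] [Fintype β]

/-- Total mass of `a` in excess of the level `τ`. -/
def excess (a : α → ℝ) (τ : ℝ) : ℝ := ∑ i, max (a i - τ) 0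

/-- Total mass of the weight `w` on the event `y ≤ f`. -/
def tailMass (w f : α → ℝ) (y : ℝ) : ℝ := ∑ i with y ≤ f i, w i

lemma exists_equiv_antitone (a : α → ℝ) :
    ∃ e : Fin (Fintype.card α) ≃ α, descSorted a = a ∘ e ∧ Antitone (a ∘ e) := by
  refine ⟨(Tuple.sort fun j => -a ((Fintype.equivFin α).symm j)).trans
    (Fintype.equivFin α).symm, rfl, fun i j hij => ?_⟩
  have := Tuple.monotone_sort (fun j => -a ((Fintype.equivFin α).symm j)) hij
  simpa using this

lemma headSum_eq {a : α → ℝ} {e : Fin (Fintype.card α) ≃ α} (he : descSorted a = a ∘ e) (k : ℕ) :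
    headSum a k = ∑ i : Fin (Fintype.card α) with i.val < k, a (e i) := by
  unfold headSum
  rw [he]
  refine sum_congr (filter_congr fun i _ => ?_) fun _ _ => rfl
  rw [Nat.lt_iff_add_one_le]
  exact_mod_cast Iff.rfl

lemma headSum_le_excess (a : α → ℝ) (k : ℕ) {τ : ℝ} (hτ : 0 ≤ τ) :
    headSum a k ≤ excess a τ + k * τ := by
  obtain ⟨e, he, -⟩ := exists_equiv_antitone a
  rw [headSum_eq he]
  have hcard : (#{i : Fin (Fintype.card α) | (i : ℕ) < k} : ℝ) ≤ k := by
    rw [Fin.card_filter_val_lt]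
    exact_mod_cast min_le_right _ _
  calc ∑ i : Fin (Fintype.card α) with i.val < k, a (e i)
      ≤ ∑ i : Fin (Fintype.card α) with i.val < k, (max (a (e i) - τ) 0 + τ) :=
        sum_le_sum fun i _ => by linarith [le_max_left (a (e i) - τ) 0]
    _ ≤ excess a τ + k * τ := by
        rw [sum_add_distrib, sum_const, nsmul_eq_mul]
        refine add_le_add ?_ (mul_le_mul_of_nonneg_right hcard hτ)
        rw [excess, ← e.sum_comp]
        exact sum_le_sum_of_subset_of_nonneg (subset_univ _) fun _ _ _ => le_max_right _ _

lemma exists_headSum_eq_excess {a : α → ℝ} (ha : ∀ i, 0 ≤ a i) (k : ℕ) :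
    ∃ τ, 0 ≤ τ ∧ headSum a k = excess a τ + k * τ := by
  obtain ⟨e, he, hanti⟩ := exists_equiv_antitone a
  rw [headSum_eq he]
  by_cases hk : k < Fintype.card α
  · refine ⟨a (e ⟨k, hk⟩), ha _, ?_⟩
    have hcard : (#{i : Fin (Fintype.card α) | (i : ℕ) < k} : ℝ) = k := by
      rw [Fin.card_filter_val_lt, min_eq_right hk.le]
    have h1 : excess a (a (e ⟨k, hk⟩))
        = ∑ i : Fin (Fintype.card α) with i.val < k, (a (e i) - a (e ⟨k, hk⟩)) := by
      rw [excess, ← e.sum_comp, sum_filter]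
      refine sum_congr rfl fun i _ => ?_
      split_ifs with h
      · exact max_eq_left (sub_nonneg.2 (hanti (show i ≤ ⟨k, hk⟩ from h.le)))
      · exact max_eq_right (sub_nonpos.2 (hanti (show (⟨k, hk⟩ : Fin _) ≤ i from not_lt.1 h)))
    rw [h1, sum_sub_distrib, sum_const, nsmul_eq_mul, hcard]
    ring
  · refine ⟨0, le_rfl, ?_⟩
    rw [filter_true_of_mem fun i _ => i.2.trans_le (not_lt.1 hk), e.sum_comp]
    simp [excess, ha]

lemma sum_le_headSum {a : α → ℝ} (ha : ∀ i, 0 ≤ a i) {S : Finset α} {k : ℕ} (hS : #S ≤ k) :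
    ∑ i ∈ S, a i ≤ headSum a k := by
  obtain ⟨τ, hτ, h⟩ := exists_headSum_eq_excess ha k
  rw [h]
  calc ∑ i ∈ S, a i ≤ ∑ i ∈ S, (max (a i - τ) 0 + τ) :=
        sum_le_sum fun i _ => by linarith [le_max_left (a i - τ) 0]
    _ ≤ excess a τ + k * τ := by
        rw [sum_add_distrib, sum_const, nsmul_eq_mul]
        refine add_le_add ?_ (mul_le_mul_of_nonneg_right (by exact_mod_cast hS) hτ)
        exact sum_le_sum_of_subset_of_nonneg (subset_univ _) fun _ _ _ => le_max_right _ _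

lemma headSum_le_tailMass {a : α → ℝ} (ha : ∀ i, 0 ≤ a i) (k : ℕ) {τ : ℝ} (hτ : 0 ≤ τ) :
    headSum a k ≤ tailMass a a τ + k * τ := by
  refine (headSum_le_excess a k hτ).trans (add_le_add_left ?_ _)
  rw [excess, tailMass, sum_filter]
  refine sum_le_sum fun i _ => ?_
  split_ifs with h
  · exact max_le (by linarith) (ha i)
  · exact max_le (by linarith) le_rfl

lemma card_mul_le_one {a : α → ℝ} (ha : IsProbDist a) {S : Finset α} {τ : ℝ}
    (hS : ∀ i ∈ S, τ ≤ a i) : #S * τ ≤ 1 := by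
  rw [← ha.2, ← nsmul_eq_mul, ← sum_const]
  exact (sum_le_sum hS).trans
    (sum_le_sum_of_subset_of_nonneg (subset_univ _) fun i _ _ => ha.1 i)

lemma maj_of_excess_le {a : α → ℝ} {b : β → ℝ} (ha : ∀ i, 0 ≤ a i)
    (h : ∀ τ, 0 ≤ τ → excess b τ ≤ excess a τ) : Maj a b := by
  intro k
  obtain ⟨τ, hτ, hk⟩ := exists_headSum_eq_excess ha k
  rw [hk]
  exact (headSum_le_excess b k hτ).trans (add_le_add_left (h τ hτ) _)

lemma excess_le_of_headSum_le {a : α → ℝ} {b : β → ℝ} (hb : ∀ i, 0 ≤ b i) {ε : ℝ}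
    (h : ∀ k : ℕ, headSum b k ≤ headSum a k + ε) {τ : ℝ} (hτ : 0 ≤ τ) :
    excess b τ ≤ excess a τ + ε := by
  classical
  have h1 : excess b τ = ∑ i with τ < b i, b i - #{i | τ < b i} * τ := by
    rw [excess, ← nsmul_eq_mul, ← sum_const, ← sum_sub_distrib, sum_filter]
    refine sum_congr rfl fun i _ => ?_
    split_ifs with h
    · exact max_eq_left (by linarith)
    · exact max_eq_right (by linarith)
  have h2 := sum_le_headSum hb (le_refl #{i | τ < b i})
  have h3 := h #{i | τ < b i}
  have h4 := headSum_le_excess a #{i | τ < b i} hτ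
  linarith

lemma excess_ge {a : α → ℝ} (ha : IsProbDist a) (τ : ℝ) :
    1 - Fintype.card α * τ ≤ excess a τ := by
  have : 1 - Fintype.card α * τ = ∑ i, (a i - τ) := by
    rw [sum_sub_distrib, ha.2]; simp
  rw [this]
  exact sum_le_sum fun i _ => le_max_left _ _

lemma excess_nonneg (a : α → ℝ) (τ : ℝ) : 0 ≤ excess a τ :=
  sum_nonneg fun _ _ => le_max_right _ _

lemma continuous_excess (a : α → ℝ) : Continuous (excess a) := by
  unfold excess; fun_prop

lemma IsProbDist.le_one {a : α → ℝ} (ha : IsProbDist a) (i : α) : a i ≤ 1 := by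
  rw [← ha.2]; exact single_le_sum (fun i _ => ha.1 i) (mem_univ i)

/-- Domination of the head sums up to `ε` gives approximate majorisation with total variation
error `ε`: clamp `b` between two levels. -/
lemma approxMajTV_of_headSum_le {a : α → ℝ} {b : β → ℝ} (ha : IsProbDist a) (hb : IsProbDist b)
    (hcard : Fintype.card α = Fintype.card β) {ε : ℝ} (hε : 0 ≤ ε)
    (h : ∀ k : ℕ, headSum b k ≤ headSum a k + ε) : ApproxMajTV a b ε := by
  have hne : Nonempty β := by
    by_contra hne
    rw [not_nonempty_iff] at hne
    simpa using hb.2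
  have hM : (0 : ℝ) < Fintype.card β := by exact_mod_cast Fintype.card_pos
  set M : ℝ := (Fintype.card β : ℝ) with hMdef
  set deficit : ℝ → ℝ := fun τ => ∑ i, max (τ - b i) 0 with hdef
  have hrel : ∀ τ, excess b τ - deficit τ = 1 - M * τ := by
    intro τ
    have : 1 - M * τ = ∑ i, (b i - τ) := by
      rw [sum_sub_distrib, hb.2]; simp [hMdef]
    rw [this, excess, hdef, ← sum_sub_distrib]
    refine sum_congr rfl fun i _ => ?_
    rcases le_total (b i) τ with h | h
    · rw [max_eq_right (by linarith), max_eq_left (by linarith)]; ring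
    · rw [max_eq_left (by linarith), max_eq_right (by linarith)]; ring
  have hmid : M * (1 / M) = 1 := by field_simp
  have hMone : 1 / M ≤ 1 := by
    rw [div_le_one hM, hMdef]; exact_mod_cast Fintype.card_pos (α := β)
  have hsumabs : ∀ τ₁ τ₂, τ₂ ≤ τ₁ → ∀ i,
      |b i - (b i - max (b i - τ₁) 0 + max (τ₂ - b i) 0)|
        = max (b i - τ₁) 0 + max (τ₂ - b i) 0 := by
    intro τ₁ τ₂ hτ i
    rcases le_total (b i) τ₁ with h1 | h1
    · rw [max_eq_right (by linarith : b i - τ₁ ≤ 0)]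
      rw [show b i - (b i - 0 + max (τ₂ - b i) 0) = -max (τ₂ - b i) 0 by ring, abs_neg,
        abs_of_nonneg (le_max_right _ _), zero_add]
    · rw [max_eq_right (by linarith : τ₂ - b i ≤ 0)]
      rw [show b i - (b i - max (b i - τ₁) 0 + 0) = max (b i - τ₁) 0 by ring,
        abs_of_nonneg (le_max_right _ _), add_zero]
  rcases le_or_gt (excess b (1 / M)) ε with hcase | hcase
  · refine ⟨fun _ => 1 / M, ⟨fun _ => by positivity, by simp [← hMdef, hM.ne']⟩, ?_, ?_⟩
    · refine maj_of_excess_le ha.1 fun τ _ => ?_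
      have h1 : excess (fun _ : β => 1 / M) τ = max (1 - M * τ) 0 := by
        simp only [excess, sum_const, card_univ, nsmul_eq_mul, ← hMdef]
        rw [mul_max_of_nonneg _ _ hM.le, mul_sub, hmid, mul_zero]
      rw [h1]
      exact max_le (by have := excess_ge ha τ; rwa [hcard] at this) (excess_nonneg a τ)
    · have h1 := hrel (1 / M)
      have h2 : ∑ i, |b i - 1 / M| = excess b (1 / M) + deficit (1 / M) := by
        rw [excess, hdef, ← sum_add_distrib]
        refine sum_congr rfl fun i _ => ?_
        rw [← hsumabs (1 / M) (1 / M) le_rfl i]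
        congr 1
        rcases le_total (b i) (1 / M) with h | h
        · rw [max_eq_right (by linarith), max_eq_left (by linarith)]; ring
        · rw [max_eq_left (by linarith), max_eq_right (by linarith)]; ring
      rw [tvd, h2]
      linarith
  · obtain ⟨τ₁, ⟨hτ₁, -⟩, h1⟩ : ε ∈ excess b '' Set.Icc (1 / M) 1 := by
      refine intermediate_value_Icc' hMone (continuous_excess b).continuousOn ⟨?_, hcase.le⟩
      have : excess b 1 = 0 :=
        sum_eq_zero fun i _ => max_eq_right (by linarith [hb.le_one i])
      linarith
    obtain ⟨τ₂, ⟨hτ₂0, hτ₂⟩, h2⟩ : ε ∈ deficit '' Set.Icc 0 (1 / M) := by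
      refine intermediate_value_Icc (by positivity) ?_ ⟨?_, ?_⟩
      · exact Continuous.continuousOn (by fun_prop)
      · have : deficit 0 = 0 :=
          sum_eq_zero fun i _ => max_eq_right (by linarith [hb.1 i])
        linarith
      · have := hrel (1 / M); linarith
    have h12 : τ₂ ≤ τ₁ := hτ₂.trans hτ₁
    set bt : β → ℝ := fun i => b i - max (b i - τ₁) 0 + max (τ₂ - b i) 0 with hbt
    have hsum : ∑ i, bt i = 1 := by
      rw [hbt, sum_add_distrib, sum_sub_distrib, hb.2]
      have h1' : ∑ i, max (b i - τ₁) 0 = ε := h1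
      have h2' : ∑ i, max (τ₂ - b i) 0 = ε := h2
      rw [h1', h2']; ring
    have hclamp : ∀ i, τ₂ ≤ bt i ∧ bt i ≤ τ₁ := by
      intro i
      simp only [hbt]
      rcases le_total (b i) τ₁ with h1 | h1 <;> rcases le_total τ₂ (b i) with h2 | h2
      · rw [max_eq_right (by linarith), max_eq_right (by linarith)]; constructor <;> linarith
      · rw [max_eq_right (by linarith), max_eq_left (by linarith)]; constructor <;> linarith
      · rw [max_eq_left (by linarith), max_eq_right (by linarith)]; constructor <;> linarith
      · rw [max_eq_left (by linarith), max_eq_left (by linarith)]; constructor <;> linarith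
    refine ⟨bt, ⟨fun i => hτ₂0.trans (hclamp i).1, hsum⟩, ?_, ?_⟩
    · refine maj_of_excess_le ha.1 fun τ hτ => ?_
      rcases le_or_gt τ₁ τ with hc | hc
      · have : excess bt τ = 0 :=
          sum_eq_zero fun i _ => max_eq_right (by linarith [(hclamp i).2])
        rw [this]; exact excess_nonneg a τ
      rcases le_or_gt τ τ₂ with hc' | hc'
      · have : excess bt τ = 1 - M * τ := by
          have h3 : excess bt τ = ∑ i, (bt i - τ) :=
            sum_congr rfl fun i _ => max_eq_left (by linarith [(hclamp i).1])
          rw [h3, sum_sub_distrib, hsum]; simp [hMdef]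
        rw [this]
        have := excess_ge ha τ
        rwa [hcard] at this
      · have : excess bt τ = excess b τ - ε := by
          rw [← h1, excess, excess, excess, ← sum_sub_distrib]
          refine sum_congr rfl fun i _ => ?_
          simp only [hbt]
          rcases le_total (b i) τ₁ with h1 | h1
          · rw [max_eq_right (by linarith : b i - τ₁ ≤ 0)]
            rcases le_total τ₂ (b i) with h2 | h2
            · rw [max_eq_right (by linarith : τ₂ - b i ≤ 0)]; ring_nf
            · rw [max_eq_left (by linarith : 0 ≤ τ₂ - b i),
                max_eq_right (by linarith : b i - τ ≤ 0), max_eq_right (by linarith)]; ring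
          · rw [max_eq_left (by linarith : 0 ≤ b i - τ₁),
              max_eq_right (by linarith : τ₂ - b i ≤ 0),
              max_eq_left (by linarith : 0 ≤ b i - τ), max_eq_left (by linarith)]; ring
        rw [this]
        linarith [excess_le_of_headSum_le hb.1 h hτ]
    · have h3 : ∑ i, |b i - bt i| = excess b τ₁ + deficit τ₂ := by
        rw [excess, hdef, ← sum_add_distrib]
        exact sum_congr rfl fun i _ => hsumabs τ₁ τ₂ h12 i
      rw [tvd, h3, h1, h2]
      linarith

lemma sum_sub_le_tvd {a b : α → ℝ} (ha : IsProbDist a) (hb : IsProbDist b) (S : Finset α) :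
    ∑ i ∈ S, (a i - b i) ≤ tvd a b := by
  have h1 : tvd a b = ∑ i, max (a i - b i) 0 := by
    have h0 : ∑ i, (a i - b i) = 0 := by rw [sum_sub_distrib, ha.2, hb.2, sub_self]
    have h2 : ∑ i, |a i - b i| = ∑ i, (2 * max (a i - b i) 0 - (a i - b i)) := by
      refine sum_congr rfl fun i _ => ?_
      rcases le_total (a i - b i) 0 with h | h
      · rw [abs_of_nonpos h, max_eq_right h]; ring
      · rw [abs_of_nonneg h, max_eq_left h]; ring
    rw [tvd, h2, sum_sub_distrib, h0, ← mul_sum]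
    ring
  rw [h1]
  exact (sum_le_sum fun i _ => le_max_left _ _).trans
    (sum_le_sum_of_subset_of_nonneg (subset_univ _) fun _ _ _ => le_max_right _ _)

lemma ApproxMajTV.sum_le_headSum {a : α → ℝ} {b : β → ℝ} {ε : ℝ} (h : ApproxMajTV a b ε)
    (hb : IsProbDist b) (S : Finset β) : ∑ i ∈ S, b i ≤ headSum a (#S : ℕ) + ε := by
  obtain ⟨bt, hbt, hmaj, htv⟩ := h
  have h1 := sum_sub_le_tvd hb hbt S
  have h2 := _root_.sum_le_headSum hbt.1 (le_refl #S)
  have h3 := hmaj #S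
  rw [sum_sub_distrib] at h1
  linarith

end Majorisation

section TensorPower

variable {α β : Type*} [Fintype α] [Fintype β]

/-- Log-likelihood ratio of `k` independent samples with respect to the uniform distribution. -/
def logLR (a : α → ℝ) (k : ℕ) (x : Fin k → α) : ℝ :=
  ∑ j, Real.log (Fintype.card α * a (x j))

lemma sum_tpow (a : α → ℝ) (k : ℕ) : ∑ x, tpow a k x = (∑ i, a i) ^ k :=
  (Fintype.sum_pow a k).symm

lemma IsProbDist.tpow {a : α → ℝ} (ha : IsProbDist a) (k : ℕ) : IsProbDist (tpow a k) :=
  ⟨fun x => prod_nonneg fun j _ => ha.1 (x j), by rw [sum_tpow, ha.2, one_pow]⟩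

lemma IsProbDist.tensor {a : α → ℝ} {b : β → ℝ} (ha : IsProbDist a) (hb : IsProbDist b) :
    IsProbDist (tensor a b) := by
  refine ⟨fun x => mul_nonneg (ha.1 _) (hb.1 _), ?_⟩
  simp only [_root_.tensor, Fintype.sum_prod_type, ← mul_sum, hb.2, mul_one, ha.2]

lemma IsProbDist.card_pos {a : α → ℝ} (ha : IsProbDist a) : 0 < Fintype.card α := by
  rw [Fintype.card_pos_iff]
  by_contra hne
  rw [not_nonempty_iff] at hne
  simpa using ha.2

lemma isProbDist_unif {N : ℕ} (hN : 0 < N) : IsProbDist (unif N) := by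
  have : (N : ℝ) ≠ 0 := by exact_mod_cast hN.ne'
  exact ⟨fun _ => by unfold unif; positivity, by simp [unif, this]⟩

lemma tpow_unif (N m : ℕ) (y : Fin m → Fin N) : tpow (unif N) m y = ((N : ℝ) ^ m)⁻¹ := by
  simp [tpow, unif]

lemma tpow_eq_exp_logLR {a : α → ℝ} (ha : IsProbDist a) {k : ℕ} {x : Fin k → α}
    (hx : tpow a k x ≠ 0) :
    tpow a k x = Real.exp (logLR a k x) * ((Fintype.card α : ℝ) ^ k)⁻¹ := by
  have hN : (0 : ℝ) < Fintype.card α := by exact_mod_cast ha.card_pos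
  have hpos : ∀ j, 0 < a (x j) := fun j =>
    (ha.1 _).lt_of_ne' (prod_ne_zero_iff.1 hx j (mem_univ j))
  rw [logLR, Real.exp_sum, prod_congr rfl fun j _ => Real.exp_log (mul_pos hN (hpos j)),
    prod_mul_distrib, prod_const, card_univ, Fintype.card_fin, tpow]
  field_simp

lemma tailMass_nonneg {w : α → ℝ} (hw : ∀ i, 0 ≤ w i) (f : α → ℝ) (y : ℝ) :
    0 ≤ tailMass w f y := sum_nonneg fun i _ => hw i

lemma tailMass_anti {w : α → ℝ} (hw : ∀ i, 0 ≤ w i) (f : α → ℝ) : Antitone (tailMass w f) :=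
  fun _ _ h => sum_le_sum_of_subset_of_nonneg
    (monotone_filter_right _ fun _ _ hi => h.trans hi) fun i _ _ => hw i

lemma tailMass_tensor_unif_le {a : α → ℝ} (ha : IsProbDist a) (n m : ℕ) {s : ℝ} :
    tailMass (tensor (tpow a n) (tpow (unif (Fintype.card α)) m))
      (tensor (tpow a n) (tpow (unif (Fintype.card α)) m))
      (Real.exp s * ((Fintype.card α : ℝ) ^ (n + m))⁻¹) ≤ tailMass (tpow a n) (logLR a n) s := by
  have hN : (0 : ℝ) < Fintype.card α := by exact_mod_cast ha.card_pos
  have hu := (isProbDist_unif ha.card_pos).tpow m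
  have h1 : ∀ x, ∑ y : Fin m → Fin (Fintype.card α),
      tensor (tpow a n) (tpow (unif (Fintype.card α)) m) (x, y) = tpow a n x := by
    intro x
    simp only [tensor, ← mul_sum, hu.2, mul_one]
  rw [tailMass, tailMass, sum_filter, sum_filter, Fintype.sum_prod_type]
  refine sum_le_sum fun x _ => ?_
  split_ifs with hs
  · rw [← h1 x]
    refine sum_le_sum fun y _ => ?_
    split_ifs
    · exact le_rfl
    · exact mul_nonneg ((ha.tpow n).1 x) (hu.1 y)
  · refine (sum_eq_zero fun y _ => ?_).le
    rw [if_neg]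
    intro hle
    simp only [tensor, tpow_unif] at hle
    have hx : tpow a n x ≠ 0 := by
      intro h0
      rw [h0, zero_mul] at hle
      exact absurd hle (not_le.2 (by positivity))
    rw [tpow_eq_exp_logLR ha hx, pow_add, mul_inv, mul_assoc] at hle
    exact hs (Real.exp_le_exp.1 (le_of_mul_le_mul_right hle (by positivity)))

lemma sum_filter_tpow_eq_tailMass {a : α → ℝ} (n : ℕ) (s : ℝ) :
    ∑ x with s ≤ logLR a n x ∧ tpow a n x ≠ 0, tpow a n x = tailMass (tpow a n) (logLR a n) s := by
  rw [← filter_filter, sum_filter_ne_zero, tailMass]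

lemma exp_le_tpow {a : α → ℝ} (ha : IsProbDist a) {n : ℕ} {s : ℝ} {x : Fin n → α}
    (hs : s ≤ logLR a n x) (hx : tpow a n x ≠ 0) :
    Real.exp s * ((Fintype.card α : ℝ) ^ n)⁻¹ ≤ tpow a n x := by
  rw [tpow_eq_exp_logLR ha hx]
  gcongr

lemma approxMajTV_of_tailMass_le {a b : α → ℝ} (ha : IsProbDist a) (hb : IsProbDist b)
    (n m : ℕ) {u e : ℝ} (he : 0 ≤ e)
    (h : ∀ s, tailMass (tpow b m) (logLR b m) (s - u) + Real.exp (-u)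
      ≤ tailMass (tpow a n) (logLR a n) s + e) :
    ApproxMajTV (tensor (tpow a n) (tpow (unif (Fintype.card α)) m))
      (tensor (tpow b m) (tpow (unif (Fintype.card α)) n)) e := by
  have hN : (0 : ℝ) < Fintype.card α := by exact_mod_cast ha.card_pos
  have hPm := (isProbDist_unif ha.card_pos).tpow m
  have hP := (ha.tpow n).tensor hPm
  have hQ := (hb.tpow m).tensor ((isProbDist_unif ha.card_pos).tpow n)
  refine approxMajTV_of_headSum_le hP hQ ?_ he fun k => ?_
  · simp [← pow_add, add_comm]
  rcases k.eq_zero_or_pos with rfl | hk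
  · have h0 := headSum_le_excess (tensor (tpow b m) (tpow (unif (Fintype.card α)) n)) 0
      zero_le_one
    have h1 : excess (tensor (tpow b m) (tpow (unif (Fintype.card α)) n)) 1 = 0 :=
      sum_eq_zero fun i _ => max_eq_right (by linarith [hQ.le_one i])
    have h2 := sum_le_headSum hP.1 (S := ∅) (k := 0) le_rfl
    rw [h1] at h0
    simp only [sum_empty] at h2
    simp only [Nat.cast_zero, zero_mul, add_zero] at h0 h2 ⊢
    linarith
  have hk' : (0 : ℝ) < k := by exact_mod_cast hk
  set s : ℝ := Real.log ((Fintype.card α : ℝ) ^ (n + m) / k) with hs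
  have hexp : Real.exp s = (Fintype.card α : ℝ) ^ (n + m) / k := Real.exp_log (by positivity)
  have hQle : headSum (tensor (tpow b m) (tpow (unif (Fintype.card α)) n)) k
      ≤ tailMass (tpow b m) (logLR b m) (s - u) + Real.exp (-u) := by
    refine (headSum_le_tailMass hQ.1 k (by positivity :
      0 ≤ Real.exp (s - u) * ((Fintype.card α : ℝ) ^ (m + n))⁻¹)).trans
      (add_le_add (tailMass_tensor_unif_le hb m n) (le_of_eq ?_))
    rw [sub_eq_add_neg, Real.exp_add, hexp, add_comm m n]
    field_simp
  have hPge : tailMass (tpow a n) (logLR a n) s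
      ≤ headSum (tensor (tpow a n) (tpow (unif (Fintype.card α)) m)) k := by
    classical
    let A : Finset (Fin n → α) := {x | s ≤ logLR a n x ∧ tpow a n x ≠ 0}
    have hsum : ∑ i ∈ A ×ˢ univ,
        tensor (tpow a n) (tpow (unif (Fintype.card α)) m) i
          = tailMass (tpow a n) (logLR a n) s := by
      rw [sum_product, ← sum_filter_tpow_eq_tailMass]
      simp only [tensor, ← mul_sum, hPm.2, mul_one]
      rfl
    rw [← hsum]
    refine sum_le_headSum hP.1 ?_
    have hle := card_mul_le_one hP (τ := 1 / k)
      (S := A ×ˢ univ) fun i hi => by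
        simp only [A, mem_product, mem_filter, mem_univ, true_and, and_true] at hi
        have := exp_le_tpow ha hi.1 hi.2
        rw [tensor, tpow_unif]
        calc 1 / (k : ℝ) = Real.exp s * ((Fintype.card α : ℝ) ^ n)⁻¹
              * ((Fintype.card α : ℝ) ^ m)⁻¹ := by rw [hexp, pow_add]; field_simp
          _ ≤ _ := by gcongr
    rw [mul_one_div, div_le_one hk'] at hle
    exact_mod_cast hle
  linarith [h s]

lemma ApproxMajTV.tailMass_le {a b : α → ℝ} (ha : IsProbDist a) (hb : IsProbDist b)
    {n m m₀ : ℕ} (hm : m₀ ≤ m) {e : ℝ}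
    (h : ApproxMajTV (tensor (tpow a n) (tpow (unif (Fintype.card α)) m))
      (tensor (tpow b m) (tpow (unif (Fintype.card α)) n)) e) (s u : ℝ) :
    tailMass (tpow b m₀) (logLR b m₀) s
      ≤ tailMass (tpow a n) (logLR a n) (s - u) + Real.exp (-u) + e := by
  classical
  obtain ⟨j, rfl⟩ := Nat.exists_eq_add_of_le hm
  have hN : (0 : ℝ) < Fintype.card α := by exact_mod_cast ha.card_pos
  have hPn := (isProbDist_unif ha.card_pos).tpow n
  have hP := (ha.tpow n).tensor ((isProbDist_unif ha.card_pos).tpow (m₀ + j))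
  have hQ := (hb.tpow (m₀ + j)).tensor hPn
  set A : Finset (Fin m₀ → α) := {x | s ≤ logLR b m₀ x ∧ tpow b m₀ x ≠ 0} with hA
  have happ : ∀ x : (Fin m₀ → α) × (Fin j → α),
      tpow b (m₀ + j) (Fin.appendEquiv m₀ j x) = tpow b m₀ x.1 * tpow b j x.2 := by
    intro x
    simp [tpow, Fin.prod_univ_add, Fin.appendEquiv]
  set S := ((A ×ˢ univ).map (Fin.appendEquiv m₀ j (α := α)).toEmbedding) ×ˢ
    (univ : Finset (Fin n → Fin (Fintype.card α))) with hS
  have hsum : ∑ i ∈ S, tensor (tpow b (m₀ + j)) (tpow (unif (Fintype.card α)) n) i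
      = tailMass (tpow b m₀) (logLR b m₀) s := by
    rw [hS, sum_product, sum_map, sum_product, ← sum_filter_tpow_eq_tailMass]
    simp only [tensor, ← mul_sum, hPn.2, mul_one, Equiv.coe_toEmbedding, happ, (hb.tpow j).2]
    rfl
  have hcard : (#S : ℝ) = #A * (Fintype.card α : ℝ) ^ j * (Fintype.card α : ℝ) ^ n := by
    rw [hS, card_product, card_map, card_product]
    simp
  have hAle := card_mul_le_one (hb.tpow m₀) (S := A) fun x hx => by
    rw [hA, mem_filter] at hx
    exact exp_le_tpow hb hx.2.1 hx.2.2
  have h1 := h.sum_le_headSum hQ S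
  have h2 := headSum_le_tailMass hP.1 #S (by positivity :
      0 ≤ Real.exp (s - u) * ((Fintype.card α : ℝ) ^ (n + (m₀ + j)))⁻¹)
  have h3 := tailMass_tensor_unif_le ha n (m₀ + j) (s := s - u)
  have h4 : (#S : ℝ) * (Real.exp (s - u) * ((Fintype.card α : ℝ) ^ (n + (m₀ + j)))⁻¹)
      ≤ Real.exp (-u) := by
    calc (#S : ℝ) * (Real.exp (s - u) * ((Fintype.card α : ℝ) ^ (n + (m₀ + j)))⁻¹)
        = (#A * (Real.exp s * ((Fintype.card α : ℝ) ^ m₀)⁻¹)) * Real.exp (-u) := by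
          rw [hcard, sub_eq_add_neg, Real.exp_add, pow_add, pow_add]
          field_simp
      _ ≤ 1 * Real.exp (-u) := by gcongr
      _ = Real.exp (-u) := one_mul _
  linarith

end TensorPower

section ModerateDeviations

variable {Ω : ℕ → Type*} [∀ n, Fintype (Ω n)]

/-- At speed `s`, the moment generating functions of `f n` under the weights `w n` are
asymptotically those of a Gaussian with mean `μ` and variance `v / s n`. -/
def GaussianMGF (s : ℕ → ℝ) (w f : ∀ n, Ω n → ℝ) (v μ : ℝ) : Prop :=
  ∀ l c : ℝ,
    (c < v * l ^ 2 / 2 + μ * l →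
      ∀ᶠ n in atTop, Real.exp (s n * c) ≤ ∑ i, w n i * Real.exp (s n * (l * f n i))) ∧
    (v * l ^ 2 / 2 + μ * l < c →
      ∀ᶠ n in atTop, ∑ i, w n i * Real.exp (s n * (l * f n i)) ≤ Real.exp (s n * c))

/-- Exponential tilting with the two tails cut off by a Chernoff bound. -/
lemma tilted_sum_le_tailMass {α : Type*} [Fintype α] {w : α → ℝ} (hw : ∀ i, 0 ≤ w i) (f : α → ℝ)
    {s l η : ℝ} (hs : 0 ≤ s) (hl : 0 ≤ l) (hη : 0 ≤ η) (y z : ℝ) :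
    Real.exp (-(s * (l * z))) * (∑ i, w i * Real.exp (s * (l * f i))
        - Real.exp (-(s * (η * z))) * ∑ i, w i * Real.exp (s * ((l + η) * f i))
        - Real.exp (s * (η * y)) * ∑ i, w i * Real.exp (s * ((l - η) * f i)))
      ≤ tailMass w f y := by
  rw [tailMass, mul_sum, mul_sum, ← sum_sub_distrib, ← sum_sub_distrib, mul_sum, sum_filter]
  refine sum_le_sum fun i _ => ?_
  have r1 : Real.exp (-(s * (η * z))) * (w i * Real.exp (s * ((l + η) * f i)))
      = w i * Real.exp (s * (l * f i)) * Real.exp (s * (η * (f i - z))) := by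
    rw [mul_left_comm, mul_assoc, ← Real.exp_add, ← Real.exp_add]; ring_nf
  have r2 : Real.exp (s * (η * y)) * (w i * Real.exp (s * ((l - η) * f i)))
      = w i * Real.exp (s * (l * f i)) * Real.exp (s * (η * (y - f i))) := by
    rw [mul_left_comm, mul_assoc, ← Real.exp_add, ← Real.exp_add]; ring_nf
  rw [r1, r2]
  have hW : 0 ≤ w i * Real.exp (s * (l * f i)) := mul_nonneg (hw i) (Real.exp_pos _).le
  have hA := (Real.exp_pos (s * (η * (f i - z)))).le
  have hB := (Real.exp_pos (s * (η * (y - f i)))).le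
  have hE := (Real.exp_pos (-(s * (l * z)))).le
  have hnonpos : ∀ A B : ℝ, 0 ≤ A → 0 ≤ B → 1 ≤ A + B →
      Real.exp (-(s * (l * z))) * (w i * Real.exp (s * (l * f i))
        - w i * Real.exp (s * (l * f i)) * A - w i * Real.exp (s * (l * f i)) * B)
      ≤ 0 := fun A B _ _ hAB =>
    mul_nonpos_of_nonneg_of_nonpos hE (by nlinarith)
  split_ifs with hi
  · rcases le_or_gt (f i) z with hi' | hi'
    · calc _ ≤ Real.exp (-(s * (l * z))) * (w i * Real.exp (s * (l * f i))) := by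
            refine mul_le_mul_of_nonneg_left ?_ hE
            have := mul_nonneg hW hA
            have := mul_nonneg hW hB
            linarith
        _ = w i * Real.exp (-(s * (l * (z - f i)))) := by
            rw [mul_left_comm, ← Real.exp_add]; ring_nf
        _ ≤ w i * 1 := by
            refine mul_le_mul_of_nonneg_left (Real.exp_le_one_iff.2 ?_) (hw i)
            have : 0 ≤ s * (l * (z - f i)) :=
              mul_nonneg hs (mul_nonneg hl (by linarith))
            linarith
        _ = w i := mul_one _
    · refine (hnonpos _ _ hA hB ?_).trans (hw i)
      have : 1 ≤ Real.exp (s * (η * (f i - z))) :=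
        Real.one_le_exp (mul_nonneg hs (mul_nonneg hη (by linarith)))
      linarith
  · refine hnonpos _ _ hA hB ?_
    have : 1 ≤ Real.exp (s * (η * (y - f i))) :=
      Real.one_le_exp (mul_nonneg hs (mul_nonneg hη (by linarith)))
    linarith

namespace GaussianMGF

variable {s : ℕ → ℝ} {w f : ∀ n, Ω n → ℝ} {v μ : ℝ}

lemma neg (h : GaussianMGF s w f v μ) : GaussianMGF s w (fun n i => -f n i) v (-μ) := by
  intro l c
  have := h (-l) c
  simpa only [neg_sq, mul_neg, neg_mul] using this

lemma tailMass_le (h : GaussianMGF s w f v μ) (hw : ∀ n i, 0 ≤ w n i) (hs : ∀ᶠ n in atTop, 0 < s n)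
    (hv : 0 < v) {y c : ℝ} (hy : μ ≤ y) (hc : 2 * v * c < (y - μ) ^ 2) :
    ∀ᶠ n in atTop, tailMass (w n) (f n) y ≤ Real.exp (-(s n * c)) := by
  set l := (y - μ) / v with hl
  have hl0 : 0 ≤ l := div_nonneg (sub_nonneg.2 hy) hv.le
  have hvl : v * l = y - μ := by rw [hl]; field_simp
  have hlt : v * l ^ 2 / 2 + μ * l < l * y - c := by
    have : 2 * v * c < v * (l * (y - μ)) := by
      calc 2 * v * c < (y - μ) ^ 2 := hc
        _ = v * l * (y - μ) := by rw [hvl]; ring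
        _ = _ := by ring
    have h2 : 2 * c < l * (y - μ) := by nlinarith
    have h3 : v * l ^ 2 = l * (y - μ) := by rw [← hvl]; ring
    rw [h3]; linarith
  filter_upwards [(h l _).2 hlt, hs] with n hn hsn
  have h1 : tailMass (w n) (f n) y
      ≤ Real.exp (-(s n * (l * y))) * ∑ i, w n i * Real.exp (s n * (l * f n i)) := by
    rw [tailMass, mul_sum, sum_filter]
    refine sum_le_sum fun i _ => ?_
    rw [mul_left_comm, ← Real.exp_add]
    split_ifs with hi
    · refine le_mul_of_one_le_right (hw n i) (Real.one_le_exp ?_)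
      have : s n * (l * y) ≤ s n * (l * f n i) := by gcongr
      linarith
    · exact mul_nonneg (hw n i) (Real.exp_pos _).le
  calc tailMass (w n) (f n) y
      ≤ Real.exp (-(s n * (l * y))) * Real.exp (s n * (l * y - c)) :=
        h1.trans (mul_le_mul_of_nonneg_left hn (Real.exp_pos _).le)
    _ = Real.exp (-(s n * c)) := by rw [← Real.exp_add]; congr 1; ring

lemma le_tailMass (h : GaussianMGF s w f v μ) (hw : ∀ n i, 0 ≤ w n i) (hs : Tendsto s atTop atTop)
    (hv : 0 < v) {y c : ℝ} (hy : μ ≤ y) (hc : (y - μ) ^ 2 < 2 * v * c) :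
    ∀ᶠ n in atTop, Real.exp (-(s n * c)) ≤ tailMass (w n) (f n) y := by
  obtain ⟨g, hg, hgc⟩ : ∃ g, 0 < g ∧
      (y + g - μ) ^ 2 + 2 * (y + g - μ) * g + g ^ 2 / 2 < 2 * v * c := by
    have hcont : Tendsto (fun g : ℝ => (y + g - μ) ^ 2 + 2 * (y + g - μ) * g + g ^ 2 / 2)
        (𝓝[>] 0) (𝓝 ((y + 0 - μ) ^ 2 + 2 * (y + 0 - μ) * 0 + 0 ^ 2 / 2)) :=
      (Continuous.tendsto (by fun_prop) 0).mono_left nhdsWithin_le_nhds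
    have := (hcont.eventually_lt_const (u := 2 * v * c) (by ring_nf; ring_nf at hc; exact hc)).and
      self_mem_nhdsWithin
    obtain ⟨g, h1, h2⟩ := this.exists
    exact ⟨g, h2, h1⟩
  set l := (y + g - μ) / v with hl
  set η := g / v with hη
  set κ := g ^ 2 / (8 * v) with hκ
  have hl0 : 0 ≤ l := div_nonneg (by linarith) hv.le
  have hη0 : 0 < η := div_pos hg hv
  have hκ0 : 0 < κ := by positivity
  set Λ := v * l ^ 2 / 2 + μ * l with hΛ
  have hvl : v * l = y + g - μ := by rw [hl]; field_simp
  have hvη : v * η = g := by rw [hη]; field_simp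
  have hκη : κ = g * η / 8 := by rw [hκ, hη]; field_simp
  have e1 : v * (l + η) ^ 2 / 2 + μ * (l + η) = Λ + η * (y + 2 * g) - 4 * κ := by
    linear_combination η * hvl + η / 2 * hvη + 4 * hκη
  have e2 : v * (l - η) ^ 2 / 2 + μ * (l - η) = Λ - η * y - 4 * κ := by
    linear_combination -η * hvl + η / 2 * hvη + 4 * hκη
  have hfin : -c < Λ - 2 * κ - l * (y + 2 * g) := by
    have h1 : v * Λ = (y + g - μ) ^ 2 / 2 + μ * (y + g - μ) := by
      rw [hΛ, ← hvl]; ring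
    have h2 : v * κ = g ^ 2 / 8 := by rw [hκη, ← hvη]; ring
    have h3 : v * (l * (y + 2 * g)) = (y + g - μ) * (y + 2 * g) := by rw [← hvl]; ring
    have : v * (-c) < v * (Λ - 2 * κ - l * (y + 2 * g)) := by
      rw [mul_sub, mul_sub, mul_left_comm v 2 κ, h1, h2, h3]
      nlinarith
    exact lt_of_mul_lt_mul_left this hv.le
  filter_upwards [(h l (Λ - κ)).1 (by linarith), (h (l + η) (Λ + η * (y + 2 * g) - 3 * κ)).2
    (by linarith), (h (l - η) (Λ - η * y - 3 * κ)).2 (by linarith),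
    hs.eventually_ge_atTop (2 / κ), hs.eventually_gt_atTop 0] with n h1 h2 h3 hκn hsn
  have hsκ : 2 ≤ s n * κ := by rwa [div_le_iff₀ hκ0] at hκn
  have hpt := tilted_sum_le_tailMass (hw n) (f n) hsn.le hl0 hη0.le y (y + 2 * g)
  refine le_trans ?_ hpt
  have hbr : Real.exp (s n * (Λ - 2 * κ)) ≤ ∑ i, w n i * Real.exp (s n * (l * f n i))
        - Real.exp (-(s n * (η * (y + 2 * g)))) * ∑ i, w n i * Real.exp (s n * ((l + η) * f n i))
        - Real.exp (s n * (η * y)) * ∑ i, w n i * Real.exp (s n * ((l - η) * f n i)) := by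
    have h2' := mul_le_mul_of_nonneg_left h2 (Real.exp_pos (-(s n * (η * (y + 2 * g))))).le
    have h3' := mul_le_mul_of_nonneg_left h3 (Real.exp_pos (s n * (η * y))).le
    rw [← Real.exp_add] at h2' h3'
    have q1 : Real.exp (s n * (Λ - κ)) = Real.exp (s n * (Λ - 2 * κ)) * Real.exp (s n * κ) := by
      rw [← Real.exp_add]; ring_nf
    have q2 : Real.exp (-(s n * (η * (y + 2 * g))) + s n * (Λ + η * (y + 2 * g) - 3 * κ))
        = Real.exp (s n * (Λ - 2 * κ)) * Real.exp (-(s n * κ)) := by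
      rw [← Real.exp_add]; ring_nf
    have q3 : Real.exp (s n * (η * y) + s n * (Λ - η * y - 3 * κ))
        = Real.exp (s n * (Λ - 2 * κ)) * Real.exp (-(s n * κ)) := by
      rw [← Real.exp_add]; ring_nf
    rw [q1] at h1
    rw [q2] at h2'
    rw [q3] at h3'
    have q4 := Real.add_one_le_exp (s n * κ)
    have q5 : Real.exp (-(s n * κ)) ≤ 1 := Real.exp_le_one_iff.2 (by linarith)
    have q6 := mul_le_mul_of_nonneg_left
      (show 1 ≤ Real.exp (s n * κ) - 2 * Real.exp (-(s n * κ)) by linarith)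
      (Real.exp_pos (s n * (Λ - 2 * κ))).le
    linarith
  calc Real.exp (-(s n * c))
      ≤ Real.exp (-(s n * (l * (y + 2 * g)))) * Real.exp (s n * (Λ - 2 * κ)) := by
        rw [← Real.exp_add]
        refine Real.exp_le_exp.2 ?_
        have := mul_le_mul_of_nonneg_left hfin.le hsn.le
        linarith
    _ ≤ _ := mul_le_mul_of_nonneg_left hbr (Real.exp_pos _).le

end GaussianMGF

lemma tailMass_add_tailMass_neg_ge {α : Type*} [Fintype α] {w : α → ℝ} (hw : IsProbDist w)
    (f : α → ℝ) (y : ℝ) : 1 ≤ tailMass w f y + tailMass w (fun i => -f i) (-y) := by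
  rw [tailMass, tailMass, sum_filter, sum_filter, ← sum_add_distrib, ← hw.2]
  refine sum_le_sum fun i _ => ?_
  have := hw.1 i
  by_cases h : y ≤ f i
  · rw [if_pos h]; split_ifs <;> linarith
  · rw [if_neg h, if_pos (by linarith)]; linarith

lemma tailMass_add_tailMass_neg_le {α : Type*} [Fintype α] {w : α → ℝ} (hw : IsProbDist w)
    (f : α → ℝ) {y z : ℝ} (hzy : z < y) :
    tailMass w f y + tailMass w (fun i => -f i) (-z) ≤ 1 := by
  rw [tailMass, tailMass, sum_filter, sum_filter, ← sum_add_distrib, ← hw.2]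
  refine sum_le_sum fun i _ => ?_
  have := hw.1 i
  by_cases h : y ≤ f i
  · rw [if_pos h, if_neg (by linarith)]; linarith
  · rw [if_neg h]; split_ifs <;> linarith

lemma tendsto_log_mgf_centered {α : Type*} [Fintype α] {a : α → ℝ} (ha : IsProbDist a) (X : α → ℝ)
    (hX : ∑ i, a i * X i = 0) :
    Tendsto (fun r : ℝ => Real.log (∑ i, a i * Real.exp (r * X i)) / r ^ 2) (𝓝[≠] 0)
      (𝓝 ((∑ i, a i * X i ^ 2) / 2)) := by
  have hpt : ∀ x : ℝ, Tendsto (fun r : ℝ => (Real.exp (r * x) - 1 - r * x) / r ^ 2) (𝓝[≠] 0)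
      (𝓝 (x ^ 2 / 2)) := by
    intro x
    have hb : ∀ᶠ r : ℝ in 𝓝[≠] 0,
        |(Real.exp (r * x) - 1 - r * x) / r ^ 2 - x ^ 2 / 2| ≤ |r| * |x| ^ 3 := by
      have h1 : ∀ᶠ r : ℝ in 𝓝[≠] 0, |r * x| < 1 := by
        have : Tendsto (fun r : ℝ => |r * x|) (𝓝[≠] 0) (𝓝 |0 * x|) :=
          (Continuous.tendsto (by fun_prop) 0).mono_left nhdsWithin_le_nhds
        exact this.eventually_lt_const (by simp)
      filter_upwards [h1, self_mem_nhdsWithin] with r hr hr0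
      have hr0' : r ≠ 0 := hr0
      have h2 := Real.exp_bound hr.le (n := 3) (by norm_num)
      simp only [sum_range_succ, sum_range_zero] at h2
      norm_num at h2
      have h3 : (Real.exp (r * x) - 1 - r * x) / r ^ 2 - x ^ 2 / 2
          = (Real.exp (r * x) - (1 + r * x + (r * x) ^ 2 / 2)) / r ^ 2 := by
        field_simp
        ring
      rw [h3, abs_div, abs_of_nonneg (sq_nonneg r), div_le_iff₀ (by positivity)]
      refine h2.trans ?_
      rw [show |r| * |x| ^ 3 * r ^ 2 = (|r| * |x|) ^ 3 by rw [← sq_abs r]; ring]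
      have : 0 ≤ (|r| * |x|) ^ 3 := by positivity
      linarith
    rw [tendsto_iff_norm_sub_tendsto_zero]
    refine squeeze_zero' (Eventually.of_forall fun _ => norm_nonneg _) hb ?_
    have : Tendsto (fun r : ℝ => |r| * |x| ^ 3) (𝓝[≠] 0) (𝓝 (|0| * |x| ^ 3)) :=
      (Continuous.tendsto (by fun_prop) 0).mono_left nhdsWithin_le_nhds
    simpa using this
  have hM : Tendsto (fun r : ℝ => ((∑ i, a i * Real.exp (r * X i)) - 1) / r ^ 2) (𝓝[≠] 0)
      (𝓝 ((∑ i, a i * X i ^ 2) / 2)) := by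
    have := tendsto_finsetSum univ fun i _ => (hpt (X i)).const_mul (a i)
    have e1 : (∑ i, a i * X i ^ 2) / 2 = ∑ i, a i * (X i ^ 2 / 2) := by
      rw [sum_div]; exact sum_congr rfl fun i _ => by ring
    rw [e1]
    refine this.congr fun r => ?_
    have e2 : ∑ i, a i * Real.exp (r * X i) - 1
        = ∑ i, a i * (Real.exp (r * X i) - 1 - r * X i) := by
      calc _ = ∑ i, a i * Real.exp (r * X i) - ∑ i, a i - r * ∑ i, a i * X i := by
            rw [hX, ha.2]; ring
        _ = _ := by
            rw [mul_sum, ← sum_sub_distrib, ← sum_sub_distrib]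
            exact sum_congr rfl fun i _ => by ring
    rw [e2, sum_div]
    exact sum_congr rfl fun i _ => by ring
  have hMcont : Tendsto (fun r : ℝ => ∑ i, a i * Real.exp (r * X i)) (𝓝[≠] 0) (𝓝 1) := by
    have : Tendsto (fun r : ℝ => ∑ i, a i * Real.exp (r * X i)) (𝓝[≠] 0)
        (𝓝 (∑ i, a i * Real.exp (0 * X i))) :=
      (Continuous.tendsto (by fun_prop) 0).mono_left nhdsWithin_le_nhds
    simpa [ha.2] using this
  have hlow := hM.div hMcont one_ne_zero
  rw [div_one] at hlow
  have hpos : ∀ᶠ r : ℝ in 𝓝[≠] 0, 0 < ∑ i, a i * Real.exp (r * X i) :=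
    hMcont.eventually_const_lt one_pos
  refine tendsto_of_tendsto_of_tendsto_of_le_of_le' hlow hM ?_ ?_
  · filter_upwards [hpos] with r hr
    have := Real.one_sub_inv_le_log_of_pos hr
    simp only [Pi.div_apply]
    rw [div_right_comm]
    gcongr
    calc _ = 1 - (∑ i, a i * Real.exp (r * X i))⁻¹ := by field_simp
      _ ≤ _ := this
  · filter_upwards [hpos] with r hr
    have := Real.log_le_sub_one_of_pos hr
    gcongr

lemma sum_tpow_mul_exp_logLR {α : Type*} [Fintype α] {a : α → ℝ} (ha : IsProbDist a) (k : ℕ)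
    (r D C : ℝ) :
    ∑ x, tpow a k x * Real.exp (r * (logLR a k x - C)) =
      Real.exp (k * Real.log (∑ i, a i * Real.exp (r * (Real.log (Fintype.card α * a i) - D)))
        + r * (k * D - C)) := by
  have hpos : 0 < ∑ i, a i * Real.exp (r * (Real.log (Fintype.card α * a i) - D)) := by
    refine lt_of_le_of_ne (sum_nonneg fun i _ => mul_nonneg (ha.1 i) (Real.exp_pos _).le) ?_
    intro h0
    have h1 := (sum_eq_zero_iff_of_nonneg fun i _ =>
      mul_nonneg (ha.1 i) (Real.exp_pos _).le).1 h0.symm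
    have h2 : ∑ i, a i = 0 := sum_eq_zero fun i hi =>
      (mul_eq_zero.1 (h1 i hi)).resolve_right (Real.exp_pos _).ne'
    rw [ha.2] at h2
    exact one_ne_zero h2
  rw [Real.exp_add, Real.exp_nat_mul, Real.exp_log hpos, ← sum_tpow, sum_mul]
  refine sum_congr rfl fun x _ => ?_
  have : tpow (fun i => a i * Real.exp (r * (Real.log (Fintype.card α * a i) - D))) k x
      = tpow a k x * Real.exp (r * (logLR a k x - k * D)) := by
    simp only [tpow, prod_mul_distrib, ← Real.exp_sum, ← mul_sum, sum_sub_distrib, logLR, sum_const,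
      card_univ, Fintype.card_fin, nsmul_eq_mul]
  rw [this, mul_assoc, ← Real.exp_add]
  ring_nf

lemma gaussianMGF_tpow {α : Type*} [Fintype α] {a : α → ℝ} (ha : IsProbDist a) {k : ℕ → ℕ}
    {C t : ℕ → ℝ} {ρ μ D : ℝ} (hD : D = ∑ i, a i * Real.log (Fintype.card α * a i))
    (ht0 : Tendsto t atTop (𝓝 0)) (htpos : ∀ᶠ n in atTop, 0 < t n)
    (hk : Tendsto (fun n : ℕ => (k n : ℝ) / n) atTop (𝓝 ρ))
    (hC : Tendsto (fun n : ℕ => (k n * D - C n) / (n * t n)) atTop (𝓝 μ)) :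
    GaussianMGF (fun n : ℕ => n * t n ^ 2) (fun n => tpow a (k n))
      (fun n x => (logLR a (k n) x - C n) / (n * t n))
      (ρ * ∑ i, a i * (Real.log (Fintype.card α * a i) - D) ^ 2) μ := by
  set X : α → ℝ := fun i => Real.log (Fintype.card α * a i) - D with hX
  set V := ∑ i, a i * X i ^ 2 with hV
  have hX0 : ∑ i, a i * X i = 0 := by
    simp only [hX, mul_sub, sum_sub_distrib, ← sum_mul, ha.2, one_mul, ← hD, sub_self]
  have key := tendsto_log_mgf_centered ha X hX0
  have main : ∀ l : ℝ, Tendsto (fun n : ℕ =>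
      (k n * Real.log (∑ i, a i * Real.exp (t n * l * X i)) + t n * l * (k n * D - C n))
        / (n * t n ^ 2)) atTop (𝓝 (ρ * V * l ^ 2 / 2 + μ * l)) := by
    intro l
    have h2 : Tendsto (fun n : ℕ => (k n : ℝ) / n *
        (Real.log (∑ i, a i * Real.exp (t n * l * X i)) / (t n * l) ^ 2 * l ^ 2)
        + (k n * D - C n) / (n * t n) * l) atTop (𝓝 (ρ * (V / 2 * l ^ 2) + μ * l)) := by
      refine (hk.mul ?_).add (hC.mul_const l)
      rcases eq_or_ne l 0 with rfl | hl
      · simp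
      · refine Tendsto.mul_const _ (key.comp (tendsto_nhdsWithin_iff.2 ⟨?_, ?_⟩))
        · simpa using ht0.mul_const l
        · filter_upwards [htpos] with n hn
          exact mul_ne_zero hn.ne' hl
    have e : ρ * V * l ^ 2 / 2 + μ * l = ρ * (V / 2 * l ^ 2) + μ * l := by ring
    rw [e]
    refine h2.congr' ?_
    filter_upwards [htpos, eventually_gt_atTop 0] with n hn hn0
    have hn' : (n : ℝ) ≠ 0 := by exact_mod_cast hn0.ne'
    rcases eq_or_ne l 0 with rfl | hl
    · simp [ha.2]
    · have := hn.ne'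
      field_simp
  have hform : ∀ᶠ n : ℕ in atTop, ∀ l : ℝ,
      ∑ x, tpow a (k n) x *
        Real.exp (n * t n ^ 2 * (l * ((logLR a (k n) x - C n) / (n * t n)))) =
      Real.exp (n * t n ^ 2 * ((k n * Real.log (∑ i, a i * Real.exp (t n * l * X i))
        + t n * l * (k n * D - C n)) / (n * t n ^ 2))) := by
    filter_upwards [htpos, eventually_gt_atTop 0] with n hn hn0 l
    have hn' : (n : ℝ) ≠ 0 := by exact_mod_cast hn0.ne'
    have := hn.ne'
    rw [mul_div_cancel₀ _ (by positivity), ← sum_tpow_mul_exp_logLR ha (k n) (t n * l) D (C n)]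
    refine sum_congr rfl fun x _ => ?_
    congr 2
    field_simp
  have hpos : ∀ᶠ n : ℕ in atTop, 0 < (n : ℝ) * t n ^ 2 := by
    filter_upwards [htpos, eventually_gt_atTop 0] with n hn hn0
    positivity
  refine fun l c => ⟨fun hc => ?_, fun hc => ?_⟩
  · filter_upwards [hform, hpos, (main l).eventually_const_lt hc] with n h1 h2 h3
    rw [h1]
    exact Real.exp_le_exp.2 (mul_le_mul_of_nonneg_left h3.le h2.le)
  · filter_upwards [hform, hpos, (main l).eventually_lt_const hc] with n h1 h2 h3
    rw [h1]
    exact Real.exp_le_exp.2 (mul_le_mul_of_nonneg_left h3.le h2.le)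

end ModerateDeviations

section Comparison

lemma exists_pos_lt_of_continuous {F G : ℝ → ℝ} (hF : Continuous F) (hG : Continuous G)
    (h : F 0 < G 0) : ∃ δ, 0 < δ ∧ F δ < G δ := by
  have h1 := ((hF.tendsto 0).mono_left (nhdsWithin_le_nhds (s := Set.Ioi 0))).eventually_lt
    ((hG.tendsto 0).mono_left nhdsWithin_le_nhds) h
  obtain ⟨δ, h2, h3⟩ := (h1.and self_mem_nhdsWithin).exists
  exact ⟨δ, h3, h2⟩

lemma eventually_mul_exp_neg_le {s : ℕ → ℝ} (hs : Tendsto s atTop atTop) {c d : ℝ} (hcd : c < d)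
    (K : ℝ) : ∀ᶠ n in atTop, K * Real.exp (-(s n * d)) < Real.exp (-(s n * c)) := by
  have h1 : Tendsto (fun n => s n * (d - c)) atTop atTop := hs.atTop_mul_const (sub_pos.2 hcd)
  filter_upwards [(Real.tendsto_exp_atTop.comp h1).eventually_gt_atTop K] with n hn
  have : Real.exp (-(s n * c)) = Real.exp (s n * (d - c)) * Real.exp (-(s n * d)) := by
    rw [← Real.exp_add]; ring_nf
  rw [this]
  exact mul_lt_mul_of_pos_right hn (Real.exp_pos _)

variable {Ω Ω' : ℕ → Type*} [∀ n, Fintype (Ω n)] [∀ n, Fintype (Ω' n)] {s : ℕ → ℝ}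
  {w f : ∀ n, Ω n → ℝ} {w' f' : ∀ n, Ω' n → ℝ} {v v' μ : ℝ}

lemma tailMass_le_one {α : Type*} [Fintype α] {w : α → ℝ} (hw : IsProbDist w) (f : α → ℝ) (y : ℝ) :
    tailMass w f y ≤ 1 := by
  rw [← hw.2]
  exact sum_le_sum_of_subset_of_nonneg (subset_univ _) fun i _ _ => hw.1 i

/-- If the mean shift exceeds the critical value, some tail of the second family exceeds the
corresponding tail of the first by more than twice `exp (-s n)`. -/
lemma exists_tailMass_add_lt (h : GaussianMGF s w f v 0) (h' : GaussianMGF s w' f' v' μ)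
    (hw : ∀ n, IsProbDist (w n)) (hw' : ∀ n, IsProbDist (w' n)) (hs : Tendsto s atTop atTop)
    (hv : 0 < v) (hv' : 0 < v') (hμ : -|√(2 * v) - √(2 * v')| < μ) :
    ∃ y δ : ℝ, 0 < δ ∧ ∀ᶠ n in atTop,
      tailMass (w n) (f n) (y - δ) + 2 * Real.exp (-s n) < tailMass (w' n) (f' n) y := by
  set p := √(2 * v) with hp
  set q := √(2 * v') with hq
  have hp0 : 0 < p := Real.sqrt_pos.2 (by linarith)
  have hq0 : 0 < q := Real.sqrt_pos.2 (by linarith)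
  have hp2 : p ^ 2 = 2 * v := Real.sq_sqrt (by linarith)
  have hq2 : q ^ 2 = 2 * v' := Real.sq_sqrt (by linarith)
  have hs0 := hs.eventually_gt_atTop 0
  rcases le_total p q with hpq | hpq
  · rw [abs_of_nonpos (by linarith)] at hμ
    obtain ⟨y, hy1, hy2⟩ := exists_between (show max p μ < q + μ from max_lt (by linarith)
      (by linarith))
    obtain ⟨hyp, hyμ⟩ := max_lt_iff.1 hy1
    obtain ⟨c, hc1, hc2⟩ := exists_between (show (y - μ) ^ 2 / (2 * v') < 1 by
      rw [div_lt_one (by linarith), ← hq2]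
      exact pow_lt_pow_left₀ (by linarith) (by linarith) two_ne_zero)
    rw [div_lt_iff₀ (by linarith), mul_comm] at hc1
    refine ⟨y, (y - p) / 2, by linarith, ?_⟩
    filter_upwards [h.tailMass_le (fun n => (hw n).1) hs0 hv (y := y - (y - p) / 2) (c := 1)
      (by linarith) (by
        rw [mul_one, ← hp2]
        exact pow_lt_pow_left₀ (by linarith) hp0.le two_ne_zero),
      h'.le_tailMass (fun n => (hw' n).1) hs hv' hyμ.le hc1,
      eventually_mul_exp_neg_le hs hc2 3] with n h1 h2 h3
    rw [mul_one] at h1 h3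
    linarith
  · rw [abs_of_nonneg (by linarith)] at hμ
    obtain ⟨y, hy1, hy2⟩ := exists_between (show -p < min 0 (μ - q) from lt_min (by linarith)
      (by linarith))
    obtain ⟨hy0, hyμ⟩ := lt_min_iff.1 hy2
    set z := y - (y + p) / 2 with hz
    have hz1 : -p < z := by linarith
    have hzy : z < y - (y + p) / 4 := by linarith
    obtain ⟨c, hc1, hc2⟩ := exists_between (show (-z - 0) ^ 2 / (2 * v) < 1 by
      rw [div_lt_one (by linarith), ← hp2]
      exact pow_lt_pow_left₀ (by linarith) (by linarith) two_ne_zero)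
    rw [div_lt_iff₀ (by linarith), mul_comm] at hc1
    refine ⟨y, (y + p) / 4, by linarith, ?_⟩
    have hneg := h.neg
    rw [neg_zero] at hneg
    filter_upwards [hneg.le_tailMass (fun n => (hw n).1) hs hv (y := -z) (c := c)
      (by linarith) hc1,
      h'.neg.tailMass_le (fun n => (hw' n).1) hs0 hv' (y := -y) (c := 1) (by linarith) (by
        rw [mul_one, ← hq2]
        exact pow_lt_pow_left₀ (by linarith) hq0.le two_ne_zero),
      eventually_mul_exp_neg_le hs hc2 3] with n h1 h2 h3
    have h4 := tailMass_add_tailMass_neg_le (hw n) (f n) hzy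
    have h5 := tailMass_add_tailMass_neg_ge (hw' n) (f' n) y
    rw [mul_one] at h2 h3
    linarith

/-- If the mean shift is below the critical value, then near every point the tail of the second
family is dominated by that of the first, up to `exp (-s n)`. -/
lemma exists_tailMass_add_le (h : GaussianMGF s w f v 0) (h' : GaussianMGF s w' f' v' μ)
    (hw : ∀ n, IsProbDist (w n)) (hw' : ∀ n, IsProbDist (w' n)) (hs : Tendsto s atTop atTop)
    (hv : 0 < v) (hv' : 0 < v') (hμ : μ < -|√(2 * v) - √(2 * v')|) {y : ℝ}
    (hy1 : -√(2 * v) ≤ y) (hy2 : y - μ ≤ √(2 * v')) :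
    ∃ δ : ℝ, 0 < δ ∧ ∀ᶠ n in atTop,
      tailMass (w' n) (f' n) (y - δ) ≤ tailMass (w n) (f n) (y + δ) := by
  set p := √(2 * v) with hp
  set q := √(2 * v') with hq
  have hp0 : 0 < p := Real.sqrt_pos.2 (by linarith)
  have hq0 : 0 < q := Real.sqrt_pos.2 (by linarith)
  have hp2 : p ^ 2 = 2 * v := Real.sq_sqrt (by linarith)
  have hq2 : q ^ 2 = 2 * v' := Real.sq_sqrt (by linarith)
  have hs0 := hs.eventually_gt_atTop 0
  have hμ1 : μ < p - q := by linarith [neg_abs_le (p - q)]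
  have hμ2 : μ < q - p := by linarith [le_abs_self (p - q)]
  have hμ0 : μ < 0 := by linarith [abs_nonneg (p - q)]
  rcases le_or_gt 0 y with hy | hy
  · have hlt : y * q < (y - μ) * p := by
      rcases le_total p q with hpq | hpq <;> nlinarith
    obtain ⟨δ, hδ, hlt'⟩ := exists_pos_lt_of_continuous (F := fun δ => (y + δ) * q)
      (G := fun δ => (y - δ - μ) * p) (by fun_prop) (by fun_prop) (by simpa using hlt)
    have hpos : 0 < y - δ - μ := pos_of_mul_pos_left
      ((mul_pos (by linarith : 0 < y + δ) hq0).trans hlt') hp0.le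
    have hdiv : (y + δ) / p < (y - δ - μ) / q := (div_lt_div_iff₀ hp0 hq0).2 hlt'
    obtain ⟨c, hc1, hc2⟩ := exists_between (pow_lt_pow_left₀ hdiv (by positivity) two_ne_zero)
    rw [div_pow, hp2, div_lt_iff₀ (by linarith)] at hc1
    rw [div_pow, hq2, lt_div_iff₀ (by linarith)] at hc2
    refine ⟨δ, hδ, ?_⟩
    filter_upwards [h.le_tailMass (fun n => (hw n).1) hs hv (y := y + δ) (c := c) (by linarith)
      (by rw [sub_zero]; linarith), h'.tailMass_le (fun n => (hw' n).1) hs0 hv' (y := y - δ) (c := c)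
      (by linarith) (by linarith)] with n h1 h2
    exact h2.trans h1
  · have hlt : max (-y + μ) 0 * p < -y * q := by
      rw [max_mul_of_nonneg _ _ hp0.le, zero_mul]
      refine max_lt ?_ (mul_pos (by linarith) hq0)
      rcases le_total p q with hpq | hpq <;> nlinarith
    obtain ⟨δ, hδ, hlt'⟩ := exists_pos_lt_of_continuous
      (F := fun δ => max (-y + 2 * δ + μ) 0 * p)
      (G := fun δ => (-y - δ) * q) (by fun_prop) (by fun_prop) (by simpa using hlt)
    have hpos : 0 < -y - δ := pos_of_mul_pos_left
      ((mul_nonneg (le_max_right _ _) hp0.le).trans_lt hlt') hq0.le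
    have hdiv : max (-y + 2 * δ + μ) 0 / q < (-y - δ) / p := (div_lt_div_iff₀ hq0 hp0).2 hlt'
    obtain ⟨c, hc1, hc2⟩ := exists_between (pow_lt_pow_left₀ hdiv (by positivity) two_ne_zero)
    rw [div_pow, hq2, div_lt_iff₀ (by linarith)] at hc1
    rw [div_pow, hp2, lt_div_iff₀ (by linarith)] at hc2
    refine ⟨δ, hδ, ?_⟩
    have hneg := h.neg
    rw [neg_zero] at hneg
    have hmax : max (-y + 2 * δ) (-μ) + μ = max (-y + 2 * δ + μ) 0 := by
      rw [max_add, neg_add_cancel]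
    filter_upwards [hneg.tailMass_le (fun n => (hw n).1) hs0 hv (y := -(y + δ)) (c := c)
      (by linarith) (by rw [sub_zero, neg_add']; linarith),
      h'.neg.le_tailMass (fun n => (hw' n).1) hs hv' (y := max (-y + 2 * δ) (-μ)) (c := c)
      (le_max_right _ _) (by rw [sub_neg_eq_add, hmax]; linarith)] with n h1 h2
    have h3 := tailMass_anti (hw' n).1 (fun i => -f' n i) (le_max_left (-y + 2 * δ) (-μ))
    have h4 := tailMass_add_tailMass_neg_le (hw' n) (f' n)
      (show y - 2 * δ < y - δ by linarith)
    have h5 := tailMass_add_tailMass_neg_ge (hw n) (f n) (y + δ)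
    rw [show -(y - 2 * δ) = -y + 2 * δ by ring] at h4
    linarith

/-- If the mean shift is below the critical value, the tails of the second family are uniformly
dominated by those of the first, up to `exp (-s n)`. -/
lemma eventually_forall_tailMass_add_le (h : GaussianMGF s w f v 0) (h' : GaussianMGF s w' f' v' μ)
    (hw : ∀ n, IsProbDist (w n)) (hw' : ∀ n, IsProbDist (w' n)) (hs : Tendsto s atTop atTop)
    (hv : 0 < v) (hv' : 0 < v') (hμ : μ < -|√(2 * v) - √(2 * v')|) {τ : ℕ → ℝ}
    (hτ : Tendsto τ atTop (𝓝 0)) :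
    ∀ᶠ n in atTop, ∀ y, tailMass (w' n) (f' n) (y - τ n) + Real.exp (-(2 * s n))
      ≤ tailMass (w n) (f n) y + Real.exp (-s n) := by
  set p := √(2 * v) with hp
  set q := √(2 * v') with hq
  have hp0 : 0 < p := Real.sqrt_pos.2 (by linarith)
  have hq0 : 0 < q := Real.sqrt_pos.2 (by linarith)
  have hp2 : p ^ 2 = 2 * v := Real.sq_sqrt (by linarith)
  have hq2 : q ^ 2 = 2 * v' := Real.sq_sqrt (by linarith)
  have hs0 := hs.eventually_gt_atTop 0
  have hsmall := eventually_mul_exp_neg_le hs one_lt_two 2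
  have upper : ∀ y₀, q + μ < y₀ → ∀ᶠ n in atTop, ∀ y ≥ y₀,
      tailMass (w' n) (f' n) (y - τ n) + Real.exp (-(2 * s n))
        ≤ tailMass (w n) (f n) y + Real.exp (-s n) := by
    intro y₀ hy₀
    obtain ⟨z, hz1, hz2⟩ := exists_between hy₀
    obtain ⟨c, hc1, hc2⟩ := exists_between (show 1 < (z - μ) ^ 2 / (2 * v') by
      rw [one_lt_div (by linarith), ← hq2]
      exact pow_lt_pow_left₀ (by linarith) hq0.le two_ne_zero)
    rw [lt_div_iff₀ (by linarith)] at hc2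
    filter_upwards [h'.tailMass_le (fun n => (hw' n).1) hs0 hv' (y := z) (c := c) (by linarith)
      (by linarith), eventually_mul_exp_neg_le hs hc1 2, hsmall,
      hτ.eventually_lt_const (sub_pos.2 hz2)] with n h1 h2 h3 h4 y hy
    have h5 := tailMass_anti (hw' n).1 (f' n) (show z ≤ y - τ n by linarith)
    have h6 := tailMass_nonneg (hw n).1 (f n) y
    rw [mul_one, mul_comm (s n) 2] at h3
    rw [mul_one] at h2
    linarith
  have lower : ∀ y₀, y₀ < -p → ∀ᶠ n in atTop, ∀ y ≤ y₀,
      tailMass (w' n) (f' n) (y - τ n) + Real.exp (-(2 * s n))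
        ≤ tailMass (w n) (f n) y + Real.exp (-s n) := by
    intro y₀ hy₀
    obtain ⟨c, hc1, hc2⟩ := exists_between (show 1 < (-y₀ - 0) ^ 2 / (2 * v) by
      rw [one_lt_div (by linarith), ← hp2]
      exact pow_lt_pow_left₀ (by linarith) hp0.le two_ne_zero)
    rw [lt_div_iff₀ (by linarith)] at hc2
    have hneg := h.neg
    rw [neg_zero] at hneg
    filter_upwards [hneg.tailMass_le (fun n => (hw n).1) hs0 hv (y := -y₀) (c := c) (by linarith)
      (by linarith), eventually_mul_exp_neg_le hs hc1 2, hsmall] with n h1 h2 h3 y hy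
    have h5 := tailMass_anti (hw n).1 (f n) hy
    have h6 := tailMass_add_tailMass_neg_ge (hw n) (f n) y₀
    have h7 := tailMass_le_one (hw' n) (f' n) (y - τ n)
    rw [mul_one, mul_comm (s n) 2] at h3
    rw [mul_one] at h2
    linarith
  have middle : ∀ᶠ n in atTop, ∀ y ∈ Set.Icc (-p - 1) (q + μ + 1),
      tailMass (w' n) (f' n) (y - τ n) + Real.exp (-(2 * s n))
        ≤ tailMass (w n) (f n) y + Real.exp (-s n) := by
    refine isCompact_Icc.induction_on (p := fun S => ∀ᶠ n in atTop, ∀ y ∈ S,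
      tailMass (w' n) (f' n) (y - τ n) + Real.exp (-(2 * s n))
        ≤ tailMass (w n) (f n) y + Real.exp (-s n)) ?_ ?_ ?_ ?_
    · simp
    · intro S T hST hT
      filter_upwards [hT] with n hn y hy using hn y (hST hy)
    · intro S T hS hT
      filter_upwards [hS, hT] with n h1 h2 y hy using hy.elim (h1 y) (h2 y)
    · intro y₀ _
      rcases lt_or_ge (q + μ) y₀ with hA | hA
      · obtain ⟨z, hz1, hz2⟩ := exists_between hA
        exact ⟨Set.Ici z, mem_nhdsWithin_of_mem_nhds (Ici_mem_nhds hz2), upper z hz1⟩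
      rcases lt_or_ge y₀ (-p) with hB | hB
      · obtain ⟨z, hz1, hz2⟩ := exists_between hB
        exact ⟨Set.Iic z, mem_nhdsWithin_of_mem_nhds (Iic_mem_nhds hz1), lower z hz2⟩
      obtain ⟨δ, hδ, hev⟩ := exists_tailMass_add_le h h' hw hw' hs hv hv' hμ (y := y₀) hB
        (by linarith)
      refine ⟨Set.Ioo (y₀ - δ / 2) (y₀ + δ / 2), mem_nhdsWithin_of_mem_nhds
        (Ioo_mem_nhds (by linarith) (by linarith)), ?_⟩
      filter_upwards [hev, hs0, hτ.eventually_lt_const (half_pos hδ)] with n h1 h2 h3 y hy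
      have h4 := tailMass_anti (hw' n).1 (f' n) (show y₀ - δ ≤ y - τ n by linarith [hy.1])
      have h5 := tailMass_anti (hw n).1 (f n) (show y ≤ y₀ + δ by linarith [hy.2])
      have h6 : Real.exp (-(2 * s n)) ≤ Real.exp (-s n) := Real.exp_le_exp.2 (by linarith)
      linarith
  filter_upwards [upper (q + μ + 1) (by linarith), lower (-p - 1) (by linarith), middle]
    with n h1 h2 h3 y
  rcases le_total (q + μ + 1) y with hy | hy
  · exact h1 y hy
  rcases le_total y (-p - 1) with hy' | hy'
  · exact h2 y hy'
  · exact h3 y ⟨hy', hy⟩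

end Comparison

section Conversion

lemma tailMass_sub_div {α : Type*} [Fintype α] (w L : α → ℝ) (C : ℝ) {T : ℝ} (hT : 0 < T) (y : ℝ) :
    tailMass w (fun x => (L x - C) / T) y = tailMass w L (C + T * y) := by
  rw [tailMass, tailMass]
  refine sum_congr (filter_congr fun x _ => ?_) fun _ _ => rfl
  rw [le_div_iff₀ hT, mul_comm y T, le_sub_iff_add_le']

variable {t : ℕ → ℝ}

lemma ModerateSeq.eventually_pos (ht : ModerateSeq t) : ∀ᶠ n in atTop, 0 < t n := by
  filter_upwards [ht.2.eventually_gt_atTop 0] with n hn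
  exact pos_of_mul_pos_right hn (Real.sqrt_nonneg _)

lemma ModerateSeq.tendsto_mul_sq (ht : ModerateSeq t) :
    Tendsto (fun n : ℕ => (n : ℝ) * t n ^ 2) atTop atTop := by
  refine (ht.2.atTop_mul_atTop₀ ht.2).congr fun n => ?_
  rw [mul_mul_mul_comm, Real.mul_self_sqrt n.cast_nonneg, sq]

lemma ModerateSeq.tendsto_mul (ht : ModerateSeq t) :
    Tendsto (fun n : ℕ => (n : ℝ) * t n) atTop atTop := by
  have h1 : Tendsto (fun n : ℕ => √(n : ℝ)) atTop atTop :=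
    Real.tendsto_sqrt_atTop.comp tendsto_natCast_atTop_atTop
  refine (h1.atTop_mul_atTop₀ ht.2).congr fun n => ?_
  rw [← mul_assoc, Real.mul_self_sqrt n.cast_nonneg]

variable {ρ : ℝ}

lemma ModerateSeq.tendsto_floor (ht : ModerateSeq t) (hρ : 0 < ρ) (r : ℝ) :
    Tendsto (fun n : ℕ => ((⌊n * (ρ + t n * r)⌋₊ : ℝ) / n - ρ) / t n) atTop (𝓝 r) := by
  have h1 : Tendsto (fun n : ℕ => r - 1 / (n * t n)) atTop (𝓝 r) := by
    simpa using tendsto_const_nhds.sub (tendsto_const_nhds (x := (1 : ℝ)).div_atTop ht.tendsto_mul)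
  have h2 : ∀ᶠ n in atTop, 0 < ρ + t n * r := by
    have : Tendsto (fun n => ρ + t n * r) atTop (𝓝 (ρ + 0 * r)) := (ht.1.mul_const r).const_add ρ
    exact this.eventually_const_lt (by simpa using hρ)
  refine tendsto_of_tendsto_of_tendsto_of_le_of_le' h1 tendsto_const_nhds ?_ ?_
  · filter_upwards [ht.eventually_pos, eventually_gt_atTop 0] with n hn hn0
    have hn' : (0 : ℝ) < n := by exact_mod_cast hn0
    have := Nat.sub_one_lt_floor (n * (ρ + t n * r))
    rw [le_div_iff₀ hn, le_sub_iff_add_le, le_div_iff₀ hn']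
    calc _ = n * (ρ + t n * r) - 1 := by field_simp; ring
      _ ≤ _ := this.le
  · filter_upwards [ht.eventually_pos, eventually_gt_atTop 0, h2] with n hn hn0 h2n
    have hn' : (0 : ℝ) < n := by exact_mod_cast hn0
    have := Nat.floor_le (a := n * (ρ + t n * r)) (by positivity)
    rw [div_le_iff₀ hn, sub_le_iff_le_add, div_le_iff₀ hn']
    linarith

lemma ModerateSeq.tendsto_floor_div (ht : ModerateSeq t) (hρ : 0 < ρ) (r : ℝ) :
    Tendsto (fun n : ℕ => (⌊n * (ρ + t n * r)⌋₊ : ℝ) / n) atTop (𝓝 ρ) := by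
  have h := ((ht.tendsto_floor hρ r).mul ht.1).add_const ρ
  rw [mul_zero, zero_add] at h
  refine h.congr' ?_
  filter_upwards [ht.eventually_pos] with n hn
  rw [div_mul_cancel₀ _ hn.ne', sub_add_cancel]

variable {α : Type*} [Fintype α] {a b : α → ℝ} {Da Db Va Vb : ℝ}

lemma gaussianMGF_source (ha : IsProbDist a) (ht : ModerateSeq t)
    (hDa : Da = ∑ i, a i * Real.log (Fintype.card α * a i))
    (hVa : Va = ∑ i, a i * (Real.log (Fintype.card α * a i) - Da) ^ 2) :
    GaussianMGF (fun n : ℕ => n * t n ^ 2) (fun n => tpow a n)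
      (fun n x => (logLR a n x - n * Da) / (n * t n)) Va 0 := by
  have h1 : Tendsto (fun n : ℕ => ((id n : ℕ) : ℝ) / n) atTop (𝓝 1) := by
    refine tendsto_const_nhds.congr' ?_
    filter_upwards [eventually_gt_atTop 0] with n hn
    have : (n : ℝ) ≠ 0 := by exact_mod_cast hn.ne'
    simp [this]
  have := gaussianMGF_tpow ha (k := id) (C := fun n => n * Da) (μ := 0) hDa ht.1 ht.eventually_pos
    h1 (by simp)
  rwa [one_mul, ← hVa] at this

lemma gaussianMGF_target (hb : IsProbDist b) (ht : ModerateSeq t) (hρ : 0 < ρ)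
    (hDb : Db = ∑ i, b i * Real.log (Fintype.card α * b i)) (hDρ : ρ * Db = Da)
    (hVb : Vb = ∑ i, b i * (Real.log (Fintype.card α * b i) - Db) ^ 2) (r : ℝ) :
    GaussianMGF (fun n : ℕ => n * t n ^ 2) (fun n => tpow b ⌊n * (ρ + t n * r)⌋₊)
      (fun n x => (logLR b ⌊n * (ρ + t n * r)⌋₊ x - n * Da) / (n * t n)) (ρ * Vb) (r * Db) := by
  have h1 : Tendsto (fun n : ℕ => (⌊n * (ρ + t n * r)⌋₊ * Db - n * Da) / (n * t n)) atTop
      (𝓝 (r * Db)) := by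
    refine ((ht.tendsto_floor hρ r).mul_const Db).congr' ?_
    filter_upwards [ht.eventually_pos, eventually_gt_atTop 0] with n hn hn0
    have hn' : (n : ℝ) ≠ 0 := by exact_mod_cast hn0.ne'
    have := hn.ne'
    rw [← hDρ]
    field_simp
  have := gaussianMGF_tpow hb (C := fun n => n * Da) hDb ht.1 ht.eventually_pos
    (ht.tendsto_floor_div hρ r) h1
  rwa [← hVb] at this

lemma eventually_approxMajTV (ha : IsProbDist a) (hb : IsProbDist b) (ht : ModerateSeq t)
    (hρ : 0 < ρ) (hDa : Da = ∑ i, a i * Real.log (Fintype.card α * a i))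
    (hDb : Db = ∑ i, b i * Real.log (Fintype.card α * b i)) (hDρ : ρ * Db = Da)
    (hVa : Va = ∑ i, a i * (Real.log (Fintype.card α * a i) - Da) ^ 2)
    (hVb : Vb = ∑ i, b i * (Real.log (Fintype.card α * b i) - Db) ^ 2)
    (hVa0 : 0 < Va) (hVb0 : 0 < Vb) {r : ℝ} (hr : r * Db < -|√(2 * Va) - √(2 * (ρ * Vb))|) :
    ∀ᶠ n : ℕ in atTop, ApproxMajTV
      (tensor (tpow a n) (tpow (unif (Fintype.card α)) ⌊n * (ρ + t n * r)⌋₊))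
      (tensor (tpow b ⌊n * (ρ + t n * r)⌋₊) (tpow (unif (Fintype.card α)) n))
      (Real.exp (-(n * t n ^ 2))) := by
  have hτ : Tendsto (fun n => 2 * t n) atTop (𝓝 0) := by simpa using ht.1.const_mul 2
  filter_upwards [eventually_forall_tailMass_add_le (gaussianMGF_source ha ht hDa hVa)
    (gaussianMGF_target hb ht hρ hDb hDρ hVb r) (fun n => ha.tpow n) (fun n => hb.tpow _)
    ht.tendsto_mul_sq hVa0 (mul_pos hρ hVb0) hr hτ, ht.eventually_pos, eventually_gt_atTop 0]
    with n h hn hn0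
  have hT : 0 < n * t n := mul_pos (by exact_mod_cast hn0) hn
  refine approxMajTV_of_tailMass_le ha hb n _ (u := 2 * (n * t n ^ 2)) (Real.exp_pos _).le
    fun x => ?_
  have := h ((x - n * Da) / (n * t n))
  rw [tailMass_sub_div _ _ _ hT, tailMass_sub_div _ _ _ hT, mul_sub, mul_div_cancel₀ _ hT.ne'] at this
  rw [show n * Da + (x - n * Da - n * t n * (2 * t n)) = x - 2 * (n * t n ^ 2) by ring,
    show n * Da + (x - n * Da) = x by ring] at this
  exact this

lemma eventually_not_approxMajTV (ha : IsProbDist a) (hb : IsProbDist b) (ht : ModerateSeq t)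
    (hρ : 0 < ρ) (hDa : Da = ∑ i, a i * Real.log (Fintype.card α * a i))
    (hDb : Db = ∑ i, b i * Real.log (Fintype.card α * b i)) (hDρ : ρ * Db = Da)
    (hVa : Va = ∑ i, a i * (Real.log (Fintype.card α * a i) - Da) ^ 2)
    (hVb : Vb = ∑ i, b i * (Real.log (Fintype.card α * b i) - Db) ^ 2)
    (hVa0 : 0 < Va) (hVb0 : 0 < Vb) {r : ℝ} (hr : -|√(2 * Va) - √(2 * (ρ * Vb))| < r * Db) :
    ∀ᶠ n : ℕ in atTop, ∀ m ≥ ⌊n * (ρ + t n * r)⌋₊, ¬ ApproxMajTV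
      (tensor (tpow a n) (tpow (unif (Fintype.card α)) m))
      (tensor (tpow b m) (tpow (unif (Fintype.card α)) n)) (Real.exp (-(n * t n ^ 2))) := by
  obtain ⟨y, δ, hδ, hev⟩ := exists_tailMass_add_lt (gaussianMGF_source ha ht hDa hVa)
    (gaussianMGF_target hb ht hρ hDb hDρ hVb r) (fun n => ha.tpow n) (fun n => hb.tpow _)
    ht.tendsto_mul_sq hVa0 (mul_pos hρ hVb0) hr
  filter_upwards [hev, ht.eventually_pos, eventually_gt_atTop 0, ht.1.eventually_lt_const hδ]
    with n h hn hn0 htδ m hm hmaj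
  have hT : 0 < n * t n := mul_pos (by exact_mod_cast hn0) hn
  rw [tailMass_sub_div _ _ _ hT, tailMass_sub_div _ _ _ hT] at h
  have h1 := hmaj.tailMass_le ha hb hm (n * Da + n * t n * y) (n * t n ^ 2)
  have h2 := tailMass_anti (ha.tpow n).1 (logLR a n)
    (show n * Da + n * t n * (y - δ) ≤ n * Da + n * t n * y - n * t n ^ 2 by
      have := mul_le_mul_of_nonneg_left htδ.le hT.le
      linarith [mul_sub (n * t n) y δ, show n * t n * t n = n * t n ^ 2 by ring])
  linarith

/-- Moderate deviation expansion of the largest number of target copies. -/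
lemma tendsto_sSup_approxMajTV (ha : IsProbDist a) (hb : IsProbDist b) (ht : ModerateSeq t)
    (hρ : 0 < ρ) (hDa : Da = ∑ i, a i * Real.log (Fintype.card α * a i))
    (hDb : Db = ∑ i, b i * Real.log (Fintype.card α * b i)) (hDb0 : 0 < Db) (hDρ : ρ * Db = Da)
    (hVa : Va = ∑ i, a i * (Real.log (Fintype.card α * a i) - Da) ^ 2)
    (hVb : Vb = ∑ i, b i * (Real.log (Fintype.card α * b i) - Db) ^ 2)
    (hVa0 : 0 < Va) (hVb0 : 0 < Vb) :
    Tendsto (fun n : ℕ => (((sSup {m : ℕ | ApproxMajTV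
        (tensor (tpow a n) (tpow (unif (Fintype.card α)) m))
        (tensor (tpow b m) (tpow (unif (Fintype.card α)) n)) (Real.exp (-(n * t n ^ 2)))} : ℕ) : ℝ)
          / n - ρ) / t n) atTop (𝓝 (-|√(2 * Va) - √(2 * (ρ * Vb))| / Db)) := by
  have conv : ∀ r, -|√(2 * Va) - √(2 * (ρ * Vb))| / Db < r → ∀ᶠ n : ℕ in atTop,
      ∀ m ∈ {m : ℕ | ApproxMajTV (tensor (tpow a n) (tpow (unif (Fintype.card α)) m))
        (tensor (tpow b m) (tpow (unif (Fintype.card α)) n)) (Real.exp (-(n * t n ^ 2)))},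
        m ≤ ⌊n * (ρ + t n * r)⌋₊ := by
    intro r hr
    filter_upwards [eventually_not_approxMajTV ha hb ht hρ hDa hDb hDρ hVa hVb hVa0 hVb0
      ((div_lt_iff₀ hDb0).1 hr)] with n hn m hm
    by_contra hlt
    exact hn m (not_le.1 hlt).le hm
  refine tendsto_order.2 ⟨fun x hx => ?_, fun x hx => ?_⟩
  · obtain ⟨r, hxr, hr⟩ := exists_between hx
    filter_upwards [(ht.tendsto_floor hρ r).eventually_const_lt hxr, ht.eventually_pos,
      conv _ (lt_add_one _), eventually_approxMajTV ha hb ht hρ hDa hDb hDρ hVa hVb hVa0 hVb0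
      ((lt_div_iff₀ hDb0).1 hr)] with n h1 hn h2 h3
    refine h1.trans_le ?_
    gcongr
    exact le_csSup ⟨_, h2⟩ h3
  · obtain ⟨r, hr, hrx⟩ := exists_between hx
    filter_upwards [(ht.tendsto_floor hρ r).eventually_lt_const hrx, ht.eventually_pos,
      conv r hr] with n h1 hn h2
    refine lt_of_le_of_lt ?_ h1
    gcongr
    exact csSup_le' h2

end Conversion

section Embedding

variable {d : ℕ} {c : Fin d → ℕ}

lemma sum_embed_mul (hc : ∀ i, 0 < c i) (a : Fin d → ℝ) (g : ℝ → ℝ) :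
    ∑ x, embed c a x * g (embed c a x) = ∑ i, a i * g (a i / c i) := by
  rw [Fintype.sum_sigma]
  refine sum_congr rfl fun i _ => ?_
  have : (c i : ℝ) ≠ 0 := by exact_mod_cast (hc i).ne'
  simp only [embed, sum_const, card_univ, Fintype.card_fin, nsmul_eq_mul]
  field_simp

lemma IsProbDist.embed {a : Fin d → ℝ} (ha : IsProbDist a) (hc : ∀ i, 0 < c i) :
    IsProbDist (embed c a) := by
  refine ⟨fun x => div_nonneg (ha.1 _) (Nat.cast_nonneg _), ?_⟩
  simpa [ha.2] using sum_embed_mul hc a fun _ => 1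

variable {N : ℕ} {γ : Fin d → ℝ}

lemma relD_eq_sum_embed (hc : ∀ i, 0 < c i) (hγ : ∀ i, γ i = (c i : ℝ) / (N : ℝ)) (a : Fin d → ℝ) :
    relD a γ = ∑ x, embed c a x * Real.log (N * embed c a x) := by
  rw [sum_embed_mul hc a fun z => Real.log (N * z), relD]
  refine sum_congr rfl fun i _ => ?_
  rw [hγ, div_div_eq_mul_div, mul_comm, mul_div_assoc, mul_comm]
  ring_nf

lemma relV_eq_sum_embed (hc : ∀ i, 0 < c i) (hγ : ∀ i, γ i = (c i : ℝ) / (N : ℝ)) (a : Fin d → ℝ) :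
    relV a γ = ∑ x, embed c a x * (Real.log (N * embed c a x) - relD a γ) ^ 2 := by
  rw [sum_embed_mul hc a fun z => (Real.log (N * z) - relD a γ) ^ 2, relV]
  refine sum_congr rfl fun i _ => ?_
  rw [hγ, div_div_eq_mul_div, mul_comm (a i) (N : ℝ), mul_div_assoc]

end Embedding

lemma neg_abs_sqrt_sub_sqrt_div {Vp Vq Dp Dq : ℝ} (hVp : 0 < Vp) (hVq : 0 < Vq) (hDp : 0 < Dp)
    (hDq : 0 < Dq) :
    -|√(2 * Vp) - √(2 * (Dp / Dq * Vq))| / Dq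
      = -(√(2 * Vp) / Dq) * |1 - 1 / √(Vp / Dp / (Vq / Dq))| := by
  have h : √(2 * (Dp / Dq * Vq)) = √(2 * Vp) * (1 / √(Vp / Dp / (Vq / Dq))) := by
    rw [one_div, ← Real.sqrt_inv, ← Real.sqrt_mul (by positivity)]
    congr 1
    field_simp
  rw [h, ← mul_one_sub, abs_mul, abs_of_nonneg (Real.sqrt_nonneg _)]
  ring

/-- Moderate deviation expansion of the optimal thermodynamic-direction conversion rate
(total variation error, vanishing error `ε_n = e^{-n t_n²}`). -/
theorem thermodynamic_direction_moderate_deviation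
    {d N : ℕ} (c : Fin d → ℕ) (hcpos : ∀ i, 0 < c i) (hcN : ∑ i, c i = N)
    (γ : Fin d → ℝ) (hγprob : IsProbDist γ) (hγ : ∀ i, γ i = (c i : ℝ) / (N : ℝ))
    (p q : Fin d → ℝ) (hp : IsProbDist p) (hq : IsProbDist q)
    (hDp : 0 < relD p γ) (hDq : 0 < relD q γ)
    (hVp : 0 < relV p γ) (hVq : 0 < relV q γ)
    (t : ℕ → ℝ) (ht : ModerateSeq t)
    (ε : ℕ → ℝ) (hε : ∀ n : ℕ, ε n = Real.exp (-((n : ℝ) * t n ^ 2)))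
    (R : ℕ → ℝ → ℝ)
    (hR : ∀ n : ℕ, ∀ e : ℝ, 0 ≤ e → R n e =
      (↑(sSup {m : ℕ | ApproxMajTV (tensor (tpow (embed c p) n) (tpow (unif N) m))
          (tensor (tpow (embed c q) m) (tpow (unif N) n)) e}) : ℝ) / (n : ℝ))
    (ν : ℝ) (hν : ν = (relV p γ / relD p γ) / (relV q γ / relD q γ)) :
    Tendsto (fun n : ℕ => (R n (ε n) - relD p γ / relD q γ) / t n) atTop
      (𝓝 (-(Real.sqrt (2 * relV p γ) / relD q γ) * |1 - 1 / Real.sqrt ν|)) := by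
  have hcard : N = Fintype.card (Σ i : Fin d, Fin (c i)) := by simp [hcN]
  have hDp' := relD_eq_sum_embed hcpos hγ p
  have hDq' := relD_eq_sum_embed hcpos hγ q
  have hVp' := relV_eq_sum_embed hcpos hγ p
  have hVq' := relV_eq_sum_embed hcpos hγ q
  have hlim := neg_abs_sqrt_sub_sqrt_div hVp hVq hDp hDq
  rw [← hν] at hlim
  rw [← hlim]
  subst hcard
  refine (tendsto_sSup_approxMajTV (hp.embed hcpos) (hq.embed hcpos) ht (div_pos hDp hDq) hDp' hDq'
    hDq (div_mul_cancel₀ _ hDq.ne') hVp' hVq' hVp hVq).congr fun n => ?_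
  rw [hR n (ε n) (by rw [hε]; positivity), hε]
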